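/- Assume Hess V ≥ −K (as quadratic forms) for some K ≥ 0, and suppose μ satisfies α(W₂(ν,μ)) ≤ I(ν|μ) for all probability measures ν, where α is nonnegative and nondecreasing with generalized inverse α^{−1}(s) = inf{ r ≥ 0 : α(r) > s }. Then the β-log-Sobolev inequality β( μ(g² log g²) ) ≤ μ(|∇g|²) holds for all g ∈ C¹_b(ℝⁿ) with μ(g²) = 1, where β(r) := inf{ s > 0 : 2√(2s) α^{−1}(s) + K (α^{−1}(s))² ≥ r } for r ≥ 0. -/

import Mathlib

open MeasureTheory ENNReal NNReal Classical

/-- A coupling of `ν` and `μ`. -/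
def IsCoupling {n : ℕ}
    (π : Measure (EuclideanSpace ℝ (Fin n) × EuclideanSpace ℝ (Fin n)))
    (ν μ : Measure (EuclideanSpace ℝ (Fin n))) : Prop :=
  π.map Prod.fst = ν ∧ π.map Prod.snd = μ

/-- The `L^p`-Wasserstein distance for the Euclidean distance. -/
noncomputable def wassersteinDist {n : ℕ} (p : ℝ)
    (ν μ : Measure (EuclideanSpace ℝ (Fin n))) : ℝ≥0∞ :=
  (⨅ (π : Measure (EuclideanSpace ℝ (Fin n) × EuclideanSpace ℝ (Fin n)))
      (_ : IsCoupling π ν μ), ∫⁻ q, edist q.1 q.2 ^ p ∂π) ^ (1 / p)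

/-- The relative entropy (Kullback information) `H(ν|μ)`. -/
noncomputable def relEntropy {n : ℕ}
    (ν μ : Measure (EuclideanSpace ℝ (Fin n))) : ℝ≥0∞ :=
  if ν ≪ μ ∧ Integrable (llr ν μ) ν then ENNReal.ofReal (∫ x, llr ν μ x ∂ν) else ⊤

/-- The Fisher information `I(ν|μ) = ∫ |∇√f|² dμ` for `ν = fμ` with `√f ∈ H¹(μ)`,
and `+∞` otherwise. -/
noncomputable def fisherInfo {n : ℕ}
    (ν μ : Measure (EuclideanSpace ℝ (Fin n))) : ℝ≥0∞ :=
  ⨅ (f : EuclideanSpace ℝ (Fin n) → ℝ) (_ : ∀ x, 0 ≤ f x)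
    (_ : ν = μ.withDensity fun x => ENNReal.ofReal (f x))
    (_ : Differentiable ℝ fun x => Real.sqrt (f x)),
    ∫⁻ x, (‖gradient (fun y => Real.sqrt (f y)) x‖₊ : ℝ≥0∞) ^ 2 ∂μ

/-- The generalized inverse `α^{−1}(s) = inf{ r ≥ 0 : α(r) > s }`. -/
noncomputable def genInv (α : ℝ → ℝ) (s : ℝ) : ℝ :=
  sInf {r : ℝ | 0 ≤ r ∧ s < α r}

/-- `β(r) := inf{ s > 0 : 2√(2s) α^{−1}(s) + K (α^{−1}(s))² ≥ r }`. -/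
noncomputable def betaOf (α : ℝ → ℝ) (K : ℝ) (r : ℝ) : ℝ :=
  sInf {s : ℝ | 0 < s ∧
    r ≤ 2 * Real.sqrt (2 * s) * genInv α s + K * genInv α s ^ 2}

/-- The one-dimensional Brunn–Minkowski inequality. -/
lemma volume_add_volume_le_of_add_mem {A B C : Set ℝ} (hA : MeasurableSet A)
    (hB : MeasurableSet B) (hA0 : A.Nonempty) (hB0 : B.Nonempty)
    (hC : ∀ a ∈ A, ∀ b ∈ B, a + b ∈ C) : volume A + volume B ≤ volume C := by
  have key : ∀ K L : Set ℝ, IsCompact K → IsCompact L → K.Nonempty → L.Nonempty → K ⊆ A → L ⊆ B →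
      volume K + volume L ≤ volume C := by
    intro K L hK hL hK0 hL0 hKA hLB
    obtain ⟨a, haK, ha⟩ := hK.exists_isGreatest hK0
    obtain ⟨b, hbL, hb⟩ := hL.exists_isLeast hL0
    have h1 : volume ((fun x => x + b) '' K) = volume K := by
      rw [Set.image_add_right, measure_preimage_add_right]
    have h2 : volume ((fun x => a + x) '' L) = volume L := by
      rw [Set.image_add_left, measure_preimage_add]
    have hmeas : MeasurableSet ((fun x => a + x) '' L) :=
      (hL.image (continuous_const.add continuous_id)).measurableSet
    have h3 : volume (((fun x => x + b) '' K) ∩ ((fun x => a + x) '' L)) = 0 := by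
      refine measure_mono_null (t := {a + b}) ?_ (by simp)
      rintro _ ⟨⟨k, hk, rfl⟩, ⟨l, hl, hkl⟩⟩
      have := ha hk
      have := hb hl
      simp only [Set.mem_singleton_iff] at *
      linarith
    rw [← h1, ← h2, ← measure_union_add_inter _ hmeas, h3, add_zero]
    refine measure_mono ?_
    rintro _ (⟨k, hk, rfl⟩ | ⟨l, hl, rfl⟩)
    · exact hC _ (hKA hk) _ (hLB hbL)
    · exact hC _ (hKA haK) _ (hLB hl)
  have approx : ∀ S : Set ℝ, MeasurableSet S → S.Nonempty →
      Nonempty {K // K ⊆ S ∧ IsCompact K ∧ K.Nonempty} ∧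
      volume S = ⨆ K : {K // K ⊆ S ∧ IsCompact K ∧ K.Nonempty}, volume K.1 := by
    rintro S hS ⟨x, hx⟩
    refine ⟨⟨{x}, by simpa using hx, isCompact_singleton, ⟨x, rfl⟩⟩, le_antisymm ?_ ?_⟩
    · refine le_of_forall_lt fun r hr => ?_
      obtain ⟨K, hKS, hK, hrK⟩ := hS.exists_lt_isCompact hr
      exact hrK.trans_le (le_iSup (fun K : {K // K ⊆ S ∧ IsCompact K ∧ K.Nonempty} => volume K.1)
        ⟨K, hKS, hK, nonempty_of_measure_ne_zero (ne_of_gt (pos_of_gt hrK))⟩)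
    · exact iSup_le fun K => measure_mono K.2.1
  obtain ⟨_, hAeq⟩ := approx A hA hA0
  obtain ⟨_, hBeq⟩ := approx B hB hB0
  rw [hAeq, hBeq]
  exact ENNReal.iSup_add_iSup_le fun K L =>
    key K.1 L.1 K.2.2.1 L.2.2.1 K.2.2.2 L.2.2.2 K.2.1 L.2.1

open scoped Pointwise in
/-- The additive Prékopa–Leindler inequality on `ℝ` for functions with supremum `1`. -/
lemma lintegral_add_lintegral_le_of_iSup_eq_one {u v h : ℝ → ℝ≥0∞} (hu : Measurable u)
    (hv : Measurable v) (hh : Measurable h) (hu1 : ⨆ x, u x = 1) (hv1 : ⨆ x, v x = 1)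
    {s t : ℝ} (hs : 0 < s) (ht : 0 < t) (hst : s + t = 1)
    (H : ∀ x y, u x ^ s * v y ^ t ≤ h (s * x + t * y)) :
    ENNReal.ofReal s * (∫⁻ x, u x) + ENNReal.ofReal t * (∫⁻ x, v x) ≤ ∫⁻ x, h x := by
  have layer : ∀ f : ℝ → ℝ≥0∞, Measurable f → (∀ x, f x ≤ 1) →
      ∫⁻ x, f x = ∫⁻ r in Set.Ioi (0 : ℝ), volume {x | ENNReal.ofReal r < f x} := by
    intro f hf hf1
    have hfin : ∀ x, f x ≠ ∞ := fun x => ((hf1 x).trans_lt one_lt_top).ne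
    calc ∫⁻ x, f x = ∫⁻ x, ENNReal.ofReal (f x).toReal := by
          simp_rw [ENNReal.ofReal_toReal (hfin _)]
      _ = ∫⁻ r in Set.Ioi (0 : ℝ), volume {x | r < (f x).toReal} :=
          lintegral_eq_lintegral_meas_lt _ (Filter.Eventually.of_forall fun _ => toReal_nonneg)
            hf.ennreal_toReal.aemeasurable
      _ = _ := by
          refine setLIntegral_congr_fun measurableSet_Ioi fun r hr => ?_
          simp_rw [ENNReal.ofReal_lt_iff_lt_toReal (le_of_lt hr) (hfin _)]
  have hule : ∀ x, u x ≤ 1 := fun x => hu1 ▸ le_iSup u x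
  have hvle : ∀ x, v x ≤ 1 := fun x => hv1 ▸ le_iSup v x
  calc _ = ∫⁻ r in Set.Ioi (0 : ℝ), (ENNReal.ofReal s * volume {x | ENNReal.ofReal r < u x}
        + ENNReal.ofReal t * volume {x | ENNReal.ofReal r < v x}) := by
        have meas : ∀ f : ℝ → ℝ≥0∞,
            Measurable fun r : ℝ => volume {x | ENNReal.ofReal r < f x} := fun f =>
          Antitone.measurable fun a b hab =>
            measure_mono fun x hx => (ENNReal.ofReal_le_ofReal hab).trans_lt hx
        rw [lintegral_add_left ((meas u).const_mul _), lintegral_const_mul _ (meas u),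
          lintegral_const_mul _ (meas v), ← layer u hu hule, ← layer v hv hvle]
    _ ≤ ∫⁻ r in Set.Ioi (0 : ℝ), volume {x | ENNReal.ofReal r < min (h x) 1} := by
        refine setLIntegral_mono_ae' measurableSet_Ioi (Filter.Eventually.of_forall fun r hr => ?_)
        rcases lt_or_ge r 1 with hr1 | hr1
        · have hlt : ENNReal.ofReal r < 1 := by
            rwa [← ENNReal.ofReal_one, ENNReal.ofReal_lt_ofReal_iff one_pos]
          obtain ⟨x₀, hx₀⟩ : ∃ x, ENNReal.ofReal r < u x := lt_iSup_iff.mp (hu1 ▸ hlt)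
          obtain ⟨y₀, hy₀⟩ : ∃ x, ENNReal.ofReal r < v x := lt_iSup_iff.mp (hv1 ▸ hlt)
          have hsm : ∀ (c : ℝ), 0 < c → ∀ S : Set ℝ,
              volume (c • S) = ENNReal.ofReal c * volume S := by
            intro c hc S
            rw [Measure.addHaar_smul, Module.finrank_self, pow_one, abs_of_pos hc]
          rw [← hsm s hs, ← hsm t ht]
          refine volume_add_volume_le_of_add_mem
            ((measurableSet_lt measurable_const hu).const_smul₀ s)
            ((measurableSet_lt measurable_const hv).const_smul₀ t)
            ⟨s • x₀, Set.smul_mem_smul_set hx₀⟩ ⟨t • y₀, Set.smul_mem_smul_set hy₀⟩ ?_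
          rintro _ ⟨x, hx, rfl⟩ _ ⟨y, hy, rfl⟩
          refine lt_min (lt_of_lt_of_le ?_ (H x y)) hlt
          have hx' : ENNReal.ofReal r < u x := hx
          have hy' : ENNReal.ofReal r < v y := hy
          calc ENNReal.ofReal r = ENNReal.ofReal r ^ s * ENNReal.ofReal r ^ t := by
                rw [← ENNReal.rpow_add_of_nonneg _ _ hs.le ht.le, hst, ENNReal.rpow_one]
            _ < u x ^ s * v y ^ t :=
                ENNReal.mul_lt_mul (ENNReal.rpow_lt_rpow hx' hs) (ENNReal.rpow_lt_rpow hy' ht)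
        · have hempty : ∀ f : ℝ → ℝ≥0∞, (∀ x, f x ≤ 1) → {x | ENNReal.ofReal r < f x} = ∅ := by
            intro f hf
            ext x
            simpa using (hf x).trans (ENNReal.one_le_ofReal.mpr hr1)
          rw [hempty u hule, hempty v hvle]
          simp
    _ = ∫⁻ x, min (h x) 1 := (layer _ (hh.min measurable_const) fun x => min_le_right _ _).symm
    _ ≤ ∫⁻ x, h x := lintegral_mono fun x => min_le_left _ _

lemma ENNReal.rpow_mul_rpow_le_add (a b : ℝ≥0∞) {s t : ℝ} (hs : 0 < s) (ht : 0 < t)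
    (hst : s + t = 1) :
    a ^ s * b ^ t ≤ ENNReal.ofReal s * a + ENNReal.ofReal t * b := by
  have hpq : (s⁻¹).HolderConjugate t⁻¹ := by
    rw [Real.holderConjugate_iff]
    exact ⟨(one_lt_inv₀ hs).mpr (by linarith), by simpa using hst⟩
  have := ENNReal.young_inequality (a ^ s) (b ^ t) hpq
  rwa [← ENNReal.rpow_mul, ← ENNReal.rpow_mul, mul_inv_cancel₀ hs.ne', mul_inv_cancel₀ ht.ne',
    ENNReal.rpow_one, ENNReal.rpow_one, ENNReal.ofReal_inv_of_pos hs, ENNReal.ofReal_inv_of_pos ht,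
    div_eq_mul_inv, div_eq_mul_inv, inv_inv, inv_inv, mul_comm a, mul_comm b] at this

lemma prekopaLeindler_real_of_bounded {u v h : ℝ → ℝ≥0∞} (hu : Measurable u)
    (hv : Measurable v) (hh : Measurable h) (hu1 : ⨆ x, u x ≠ ∞) (hv1 : ⨆ x, v x ≠ ∞)
    {s t : ℝ} (hs : 0 < s) (ht : 0 < t) (hst : s + t = 1)
    (H : ∀ x y, u x ^ s * v y ^ t ≤ h (s * x + t * y)) :
    (∫⁻ x, u x) ^ s * (∫⁻ x, v x) ^ t ≤ ∫⁻ x, h x := by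
  set a := ⨆ x, u x with ha
  set b := ⨆ x, v x with hb
  rcases eq_or_ne a 0 with ha0 | ha0
  · have : ∀ x, u x = 0 := fun x => le_antisymm (ha0 ▸ le_iSup u x) zero_le
    simp [this, ENNReal.zero_rpow_of_pos hs]
  rcases eq_or_ne b 0 with hb0 | hb0
  · have : ∀ x, v x = 0 := fun x => le_antisymm (hb0 ▸ le_iSup v x) zero_le
    simp [this, ENNReal.zero_rpow_of_pos ht]
  set c := a ^ s * b ^ t with hc
  have hc0 : c ≠ 0 := mul_ne_zero (by simp [ENNReal.rpow_eq_zero_iff, ha0, hu1])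
    (by simp [ENNReal.rpow_eq_zero_iff, hb0, hv1])
  have hctop : c ≠ ∞ := ENNReal.mul_ne_top (ENNReal.rpow_ne_top_of_nonneg hs.le hu1)
    (ENNReal.rpow_ne_top_of_nonneg ht.le hv1)
  have hcinv : c⁻¹ = a⁻¹ ^ s * b⁻¹ ^ t := by
    rw [hc, ENNReal.mul_inv (by right; exact ENNReal.rpow_ne_top_of_nonneg ht.le hv1)
      (by left; exact ENNReal.rpow_ne_top_of_nonneg hs.le hu1), ENNReal.inv_rpow, ENNReal.inv_rpow]
  have key := lintegral_add_lintegral_le_of_iSup_eq_one (u := fun x => a⁻¹ * u x)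
    (v := fun x => b⁻¹ * v x) (h := fun x => c⁻¹ * h x) (hu.const_mul _) (hv.const_mul _)
    (hh.const_mul _) (by rw [← ENNReal.mul_iSup, ENNReal.inv_mul_cancel ha0 hu1])
    (by rw [← ENNReal.mul_iSup, ENNReal.inv_mul_cancel hb0 hv1]) hs ht hst (fun x y => by
      rw [ENNReal.mul_rpow_of_nonneg _ _ hs.le, ENNReal.mul_rpow_of_nonneg _ _ ht.le, hcinv,
        mul_mul_mul_comm]
      gcongr
      exact H x y)
  have key2 := (ENNReal.rpow_mul_rpow_le_add _ _ hs ht hst).trans key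
  rw [lintegral_const_mul _ hu, lintegral_const_mul _ hv, lintegral_const_mul _ hh,
    ENNReal.mul_rpow_of_nonneg _ _ hs.le, ENNReal.mul_rpow_of_nonneg _ _ ht.le,
    mul_mul_mul_comm, ← hcinv] at key2
  exact (ENNReal.mul_le_mul_iff_right (ENNReal.inv_ne_zero.mpr hctop)
    (ENNReal.inv_ne_top.mpr hc0)).mp key2

/-- The Prékopa–Leindler inequality on `ℝ`. -/
lemma prekopaLeindler_real {u v h : ℝ → ℝ≥0∞} (hu : Measurable u)
    (hv : Measurable v) (hh : Measurable h) {s t : ℝ} (hs : 0 < s) (ht : 0 < t) (hst : s + t = 1)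
    (H : ∀ x y, u x ^ s * v y ^ t ≤ h (s * x + t * y)) :
    (∫⁻ x, u x) ^ s * (∫⁻ x, v x) ^ t ≤ ∫⁻ x, h x := by
  rcases eq_or_ne (∫⁻ x, u x) 0 with hu0 | hu0
  · simp [hu0, ENNReal.zero_rpow_of_pos hs]
  rcases eq_or_ne (∫⁻ x, v x) 0 with hv0 | hv0
  · simp [hv0, ENNReal.zero_rpow_of_pos ht]
  have trunc : ∀ f : ℝ → ℝ≥0∞, Measurable f → Filter.Tendsto
      (fun k : ℕ => ∫⁻ x, min (f x) k) Filter.atTop (nhds (∫⁻ x, f x)) := by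
    intro f hf
    refine lintegral_tendsto_of_tendsto_of_monotone
      (fun k => (hf.min measurable_const).aemeasurable)
      (Filter.Eventually.of_forall fun x k l hkl => min_le_min_left _ (by exact_mod_cast hkl))
      (Filter.Eventually.of_forall fun x => ?_)
    simpa using (tendsto_const_nhds (x := f x)).min ENNReal.tendsto_nat_nhds_top
  have hrpow : ∀ {a : ℝ≥0∞} {r : ℝ}, a ≠ 0 → 0 < r → a ^ r ≠ 0 := fun {a r} ha hr => by
    simp [ENNReal.rpow_eq_zero_iff, ha, hr.not_gt]
  refine le_of_tendsto' (ENNReal.Tendsto.mul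
    ((ENNReal.continuous_rpow_const (y := s)).continuousAt.tendsto.comp (trunc u hu))
    (Or.inl (hrpow hu0 hs))
    ((ENNReal.continuous_rpow_const (y := t)).continuousAt.tendsto.comp (trunc v hv))
    (Or.inl (hrpow hv0 ht))) fun k => ?_
  refine prekopaLeindler_real_of_bounded (hu.min measurable_const) (hv.min measurable_const) hh
    ?_ ?_ hs ht hst fun x y => le_trans ?_ (H x y)
  · exact ((iSup_le fun x => min_le_right _ _).trans_lt (ENNReal.natCast_lt_top k)).ne
  · exact ((iSup_le fun x => min_le_right _ _).trans_lt (ENNReal.natCast_lt_top k)).ne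
  · gcongr <;> exact min_le_left _ _

/-- The Prékopa–Leindler inequality on `Fin n → ℝ`. -/
lemma prekopaLeindler_pi {s t : ℝ} (hs : 0 < s) (ht : 0 < t) (hst : s + t = 1) (n : ℕ) :
    ∀ {u v h : (Fin n → ℝ) → ℝ≥0∞}, Measurable u → Measurable v → Measurable h →
    (∀ x y, u x ^ s * v y ^ t ≤ h (s • x + t • y)) →
    (∫⁻ x, u x) ^ s * (∫⁻ x, v x) ^ t ≤ ∫⁻ x, h x := by
  induction n with
  | zero =>
    intro u v h hu hv hh H
    rw [Measure.volume_pi_eq_dirac 0]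
    simpa using H 0 0
  | succ n ih =>
    intro u v h hu hv hh H
    have hcons_eq : ∀ p : ℝ × (Fin n → ℝ), (Fin.cons p.1 p.2 : Fin (n + 1) → ℝ) =
        (MeasurableEquiv.piFinSuccAbove (fun _ : Fin (n + 1) => ℝ) 0).symm p := fun p => by
      simp [MeasurableEquiv.piFinSuccAbove, Fin.insertNthEquiv]
    have hcons : Measurable fun p : ℝ × (Fin n → ℝ) => (Fin.cons p.1 p.2 : Fin (n + 1) → ℝ) := by
      simp_rw [hcons_eq]
      exact MeasurableEquiv.measurable _
    have split : ∀ f : (Fin (n + 1) → ℝ) → ℝ≥0∞, Measurable f →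
        ∫⁻ x, f x = ∫⁻ r : ℝ, ∫⁻ x : Fin n → ℝ, f (Fin.cons r x) := by
      intro f hf
      rw [← ((volume_preserving_piFinSuccAbove (fun _ : Fin (n + 1) => ℝ) 0).symm
        _).lintegral_comp hf, Measure.volume_eq_prod]
      simp_rw [← hcons_eq]
      exact lintegral_prod _ (hf.comp hcons).aemeasurable
    have hm : ∀ f : (Fin (n + 1) → ℝ) → ℝ≥0∞, Measurable f →
        Measurable fun r : ℝ => ∫⁻ x : Fin n → ℝ, f (Fin.cons r x) := fun f hf =>
      (hf.comp hcons).lintegral_prod_right'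
    rw [split u hu, split v hv, split h hh]
    refine prekopaLeindler_real (hm u hu) (hm v hv) (hm h hh) hs ht hst fun a b => ?_
    have hc : ∀ r : ℝ, Measurable fun x : Fin n → ℝ => (Fin.cons r x : Fin (n + 1) → ℝ) :=
      fun r => hcons.comp measurable_prodMk_left
    refine ih (hu.comp (hc a)) (hv.comp (hc b)) (hh.comp (hc _)) fun x y => ?_
    convert H (Fin.cons a x) (Fin.cons b y) using 2
    ext i
    refine Fin.cases ?_ (fun j => ?_) i <;> simp

/-- The Prékopa–Leindler inequality on Euclidean space. -/
lemma prekopaLeindler {s t : ℝ} (hs : 0 < s) (ht : 0 < t) (hst : s + t = 1) {n : ℕ}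
    {u v h : EuclideanSpace ℝ (Fin n) → ℝ≥0∞} (hu : Measurable u) (hv : Measurable v)
    (hh : Measurable h) (H : ∀ x y, u x ^ s * v y ^ t ≤ h (s • x + t • y)) :
    (∫⁻ x, u x) ^ s * (∫⁻ x, v x) ^ t ≤ ∫⁻ x, h x := by
  have hp := PiLp.volume_preserving_toLp (Fin n)
  rw [← hp.lintegral_comp hu, ← hp.lintegral_comp hv, ← hp.lintegral_comp hh]
  exact prekopaLeindler_pi hs ht hst n (hu.comp hp.measurable) (hv.comp hp.measurable)
    (hh.comp hp.measurable) fun x y => H _ _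

lemma integrable_continuous_mul {X : Type*} [TopologicalSpace X] [MeasurableSpace X]
    [OpensMeasurableSpace X] {μ : Measure X} {F w : X → ℝ} (hF : Continuous F)
    (hFb : ∃ C, ∀ x, |F x| ≤ C) (hw : Integrable w μ) : Integrable (fun x => F x * w x) μ := by
  obtain ⟨C, hC⟩ := hFb
  exact hw.bdd_mul (c := C) hF.measurable.aestronglyMeasurable (Filter.Eventually.of_forall hC)

/-- The Prékopa–Leindler inequality for a `ρ`-strongly log-concave weight `e^{-U}`, applied to an
upper bound of the sup-convolution of `Q`, gives an entropy estimate. -/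
lemma entropy_le_of_le_add_sq {n : ℕ} {U : EuclideanSpace ℝ (Fin n) → ℝ}
    (hU : Continuous U) (hint : Integrable fun x => Real.exp (-U x)) {ρ s t : ℝ}
    (hs : 0 < s) (ht : 0 < t) (hst : s + t = 1)
    (hconv : ∀ x y, U (s • x + t • y) ≤ s * U x + t * U y - ρ * s * t / 2 * ‖x - y‖ ^ 2)
    {Q S : EuclideanSpace ℝ (Fin n) → ℝ} (hQ : Continuous Q) {B : ℝ} (hB : ∀ x, |Q x| ≤ B)
    (hS : Continuous S) (hS0 : ∀ x, 0 ≤ S x) {S₀ : ℝ} (hS₀ : ∀ x, S x ≤ S₀)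
    (hQS : ∀ x z, Q x ≤ Q z + t * S z / s + ρ * s / (2 * t) * ‖x - z‖ ^ 2) :
    (∫ x, Q x * Real.exp (Q x) * Real.exp (-U x)) - (∫ x, Real.exp (Q x) * Real.exp (-U x)) *
        Real.log ((∫ x, Real.exp (Q x) * Real.exp (-U x)) / ∫ x, Real.exp (-U x)) ≤
      Real.exp (t * S₀ / s) / s * ∫ x, S x * Real.exp (Q x) * Real.exp (-U x) := by
  have hexpb : ∀ (F : EuclideanSpace ℝ (Fin n) → ℝ) (C : ℝ), (∀ x, |F x| ≤ C) →
      ∀ x, |Real.exp (F x)| ≤ Real.exp C := fun F C h x => by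
    rw [Real.abs_exp]
    exact Real.exp_le_exp.mpr (le_of_abs_le (h x))
  have hQe : ∀ x, |Real.exp (Q x)| ≤ Real.exp B := hexpb Q B hB
  have hSabs : ∀ x, |S x| ≤ S₀ := fun x => by rw [abs_of_nonneg (hS0 x)]; exact hS₀ x
  have iA : Integrable fun x => Real.exp (Q x) * Real.exp (-U x) :=
    integrable_continuous_mul (by fun_prop) ⟨_, hQe⟩ hint
  have iE : Integrable fun x => Q x * Real.exp (Q x) * Real.exp (-U x) :=
    integrable_continuous_mul (by fun_prop) ⟨B * Real.exp B, fun x => by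
      rw [abs_mul]
      exact mul_le_mul (hB x) (hQe x) (abs_nonneg _) ((abs_nonneg _).trans (hB x))⟩ hint
  have iS : Integrable fun x => S x * Real.exp (Q x) * Real.exp (-U x) :=
    integrable_continuous_mul (by fun_prop) ⟨S₀ * Real.exp B, fun x => by
      rw [abs_mul]
      exact mul_le_mul (hSabs x) (hQe x) (abs_nonneg _) ((abs_nonneg _).trans (hSabs x))⟩ hint
  have iu : Integrable fun x => Real.exp (Q x / s) * Real.exp (-U x) :=
    integrable_continuous_mul (by fun_prop) ⟨_, hexpb _ (B / s) fun x => by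
      rw [abs_div, abs_of_pos hs]
      exact div_le_div_of_nonneg_right (hB x) hs.le⟩ hint
  have ih : Integrable fun x => Real.exp (Q x + t * S x / s) * Real.exp (-U x) :=
    integrable_continuous_mul (by fun_prop) ⟨_, hexpb _ (B + t * S₀ / s) fun x => by
      refine (abs_add_le _ _).trans (add_le_add (hB x) ?_)
      rw [abs_div, abs_of_pos hs, abs_mul, abs_of_pos ht]
      exact div_le_div_of_nonneg_right (mul_le_mul_of_nonneg_left (hSabs x) ht.le) hs.le⟩ hint
  set A := ∫ x, Real.exp (Q x) * Real.exp (-U x) with hA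
  set E := ∫ x, Q x * Real.exp (Q x) * Real.exp (-U x) with hE
  set W := ∫ x, Real.exp (-U x) with hW
  have hApos : 0 < A := by
    rw [hA]
    simp_rw [← Real.exp_add] at iA ⊢
    exact integral_exp_pos iA
  have hWpos : 0 < W := integral_exp_pos hint
  have hPL : (∫ x, Real.exp (Q x / s) * Real.exp (-U x)) ^ s * W ^ t ≤
      ∫ x, Real.exp (Q x + t * S x / s) * Real.exp (-U x) := by
    have h := prekopaLeindler hs ht hst
      (u := fun x => ENNReal.ofReal (Real.exp (Q x / s) * Real.exp (-U x)))
      (v := fun x => ENNReal.ofReal (Real.exp (-U x)))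
      (h := fun x => ENNReal.ofReal (Real.exp (Q x + t * S x / s) * Real.exp (-U x)))
      (ENNReal.measurable_ofReal.comp (Continuous.measurable (by fun_prop)))
      (ENNReal.measurable_ofReal.comp (Continuous.measurable (by fun_prop)))
      (ENNReal.measurable_ofReal.comp (Continuous.measurable (by fun_prop))) (fun x y => by
        rw [ENNReal.ofReal_rpow_of_pos (by positivity), ENNReal.ofReal_rpow_of_pos (by positivity),
          ← ENNReal.ofReal_mul (by positivity)]
        refine ENNReal.ofReal_le_ofReal ?_
        rw [← Real.exp_add, ← Real.exp_add, ← Real.exp_mul, ← Real.exp_mul, ← Real.exp_add]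
        refine Real.exp_le_exp.mpr ?_
        have h1 := hconv x y
        have h2 := hQS x (s • x + t • y)
        have h3 : x - (s • x + t • y) = t • (x - y) := by
          have : s = 1 - t := by linarith
          subst this
          module
        rw [h3, norm_smul, Real.norm_of_nonneg ht.le, mul_pow] at h2
        have h4 : ρ * s / (2 * t) * (t ^ 2 * ‖x - y‖ ^ 2) = ρ * s * t / 2 * ‖x - y‖ ^ 2 := by
          field_simp
        have h5 : (Q x / s + -U x) * s = Q x - s * U x := by field_simp; ring
        rw [h5]
        linarith)
    rw [← ofReal_integral_eq_lintegral_ofReal iu (Filter.Eventually.of_forall fun x => by positivity),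
      ← ofReal_integral_eq_lintegral_ofReal hint
        (Filter.Eventually.of_forall fun x => by positivity),
      ← ofReal_integral_eq_lintegral_ofReal ih
        (Filter.Eventually.of_forall fun x => by positivity),
      ENNReal.ofReal_rpow_of_nonneg (integral_nonneg fun x => by positivity) hs.le,
      ENNReal.ofReal_rpow_of_pos hWpos, ← ENNReal.ofReal_mul
        (Real.rpow_nonneg (integral_nonneg fun x => by positivity) _)] at h
    exact (ENNReal.ofReal_le_ofReal_iff (integral_nonneg fun x => by positivity)).mp h
  set m := t * E / (s * A) with hm
  have hJ : A * Real.exp m ≤ ∫ x, Real.exp (Q x / s) * Real.exp (-U x) := by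
    calc A * Real.exp m = ∫ x, (Real.exp m * (1 - m) * (Real.exp (Q x) * Real.exp (-U x)) +
          Real.exp m * (t / s) * (Q x * Real.exp (Q x) * Real.exp (-U x))) := by
          rw [integral_add (iA.const_mul _) (iE.const_mul _), integral_const_mul,
            integral_const_mul, ← hA, ← hE, hm]
          field_simp
          ring
      _ ≤ _ := by
          refine integral_mono ((iA.const_mul _).add (iE.const_mul _)) iu fun x => ?_
          have h1 : Real.exp (Q x / s) =
              Real.exp m * Real.exp (t * Q x / s - m) * Real.exp (Q x) := by
            rw [← Real.exp_add, ← Real.exp_add]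
            congr 1
            have : t = 1 - s := by linarith
            rw [this]
            field_simp
            ring
          have h2 := Real.add_one_le_exp (t * Q x / s - m)
          simp only [h1]
          calc _ = Real.exp m * (t * Q x / s - m + 1) * Real.exp (Q x) * Real.exp (-U x) := by ring
            _ ≤ _ := by gcongr
  have hlog : s * (Real.log A + m) + t * Real.log W ≤
      Real.log (∫ x, Real.exp (Q x + t * S x / s) * Real.exp (-U x)) := by
    have h1 : (A * Real.exp m) ^ s * W ^ t ≤
        ∫ x, Real.exp (Q x + t * S x / s) * Real.exp (-U x) :=
      le_trans (by gcongr) hPL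
    have h2 := Real.log_le_log (by positivity) h1
    rwa [Real.log_mul (by positivity) (by positivity), Real.log_rpow (by positivity),
      Real.log_rpow hWpos, Real.log_mul hApos.ne' (Real.exp_pos _).ne', Real.log_exp] at h2
  have hup : (∫ x, Real.exp (Q x + t * S x / s) * Real.exp (-U x)) ≤
      A + t * (Real.exp (t * S₀ / s) / s * ∫ x, S x * Real.exp (Q x) * Real.exp (-U x)) := by
    rw [hA, ← integral_const_mul, ← integral_const_mul, ← integral_add iA
      ((iS.const_mul _).const_mul _)]
    refine integral_mono ih (iA.add ((iS.const_mul _).const_mul _)) fun x => ?_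
    have h1 : Real.exp (t * S x / s) ≤ 1 + t * S x / s * Real.exp (t * S₀ / s) := by
      have h2 := Real.add_one_le_exp (-(t * S x / s))
      have h3 : Real.exp (-(t * S x / s)) * Real.exp (t * S x / s) = 1 := by
        rw [← Real.exp_add]; simp
      have h4 : Real.exp (t * S x / s) ≤ Real.exp (t * S₀ / s) := by
        refine Real.exp_le_exp.mpr ?_
        have := hS₀ x
        gcongr
      have h5 : 0 ≤ t * S x / s := div_nonneg (mul_nonneg ht.le (hS0 x)) hs.le
      nlinarith [Real.exp_pos (t * S x / s), mul_le_mul_of_nonneg_left h4 h5]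
    calc Real.exp (Q x + t * S x / s) * Real.exp (-U x)
        = Real.exp (t * S x / s) * (Real.exp (Q x) * Real.exp (-U x)) := by
          rw [Real.exp_add]; ring
      _ ≤ (1 + t * S x / s * Real.exp (t * S₀ / s)) * (Real.exp (Q x) * Real.exp (-U x)) := by
          gcongr
      _ = _ := by ring
  set T := Real.exp (t * S₀ / s) / s * ∫ x, S x * Real.exp (Q x) * Real.exp (-U x) with hT
  have hP : 0 < ∫ x, Real.exp (Q x + t * S x / s) * Real.exp (-U x) := by
    simp_rw [← Real.exp_add] at ih ⊢
    exact integral_exp_pos ih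
  have hlog2 : Real.log (∫ x, Real.exp (Q x + t * S x / s) * Real.exp (-U x)) ≤
      Real.log A + t * T / A := by
    have h1 := Real.log_le_sub_one_of_pos (div_pos hP hApos)
    rw [Real.log_div hP.ne' hApos.ne'] at h1
    have h2 : (∫ x, Real.exp (Q x + t * S x / s) * Real.exp (-U x)) / A ≤ 1 + t * T / A := by
      rw [div_le_iff₀ hApos]
      refine hup.trans (le_of_eq ?_)
      field_simp
    linarith
  have h3 : s * (Real.log A + m) + t * Real.log W ≤ Real.log A + t * T / A := hlog.trans hlog2
  have h4 : s * m = t * E / A := by rw [hm]; field_simp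
  have h5 : t * (E / A - (Real.log A - Real.log W)) ≤ t * (T / A) := by
    have : s = 1 - t := by linarith
    have h6 : s * Real.log A = Real.log A - t * Real.log A := by rw [this]; ring
    have h7 : t * E / A = t * (E / A) := by ring
    have h8 : t * T / A = t * (T / A) := by ring
    nlinarith
  have h6 := le_of_mul_le_mul_left h5 ht
  rw [Real.log_div hApos.ne' hWpos.ne']
  have h7 := mul_le_mul_of_nonneg_left h6 hApos.le
  have h8 : A * (E / A - (Real.log A - Real.log W)) = E - A * (Real.log A - Real.log W) := by
    field_simp
  have h9 : A * (T / A) = T := by field_simp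
  rw [h8, h9] at h7
  exact h7

/-- The logarithmic Sobolev inequality for a `ρ`-strongly log-concave weight `e^{-U}`. -/
lemma logSobolev_of_stronglyConvex {n : ℕ} {U : EuclideanSpace ℝ (Fin n) → ℝ}
    (hU : Continuous U) (hint : Integrable fun x => Real.exp (-U x)) {ρ : ℝ} (hρ : 0 < ρ)
    (hconv : ∀ x y (s t : ℝ), 0 < s → 0 < t → s + t = 1 →
      U (s • x + t • y) ≤ s * U x + t * U y - ρ * s * t / 2 * ‖x - y‖ ^ 2)
    {Q : EuclideanSpace ℝ (Fin n) → ℝ} (hQ : ContDiff ℝ 1 Q) (hQc : HasCompactSupport Q) :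
    (∫ x, Q x * Real.exp (Q x) * Real.exp (-U x)) - (∫ x, Real.exp (Q x) * Real.exp (-U x)) *
        Real.log ((∫ x, Real.exp (Q x) * Real.exp (-U x)) / ∫ x, Real.exp (-U x)) ≤
      1 / (2 * ρ) * ∫ x, ‖fderiv ℝ Q x‖ ^ 2 * Real.exp (Q x) * Real.exp (-U x) := by
  obtain ⟨B, hB⟩ := hQc.exists_bound_of_continuous hQ.continuous
  have hDc : Continuous (fderiv ℝ Q) := hQ.continuous_fderiv one_ne_zero
  obtain ⟨L₀, hL₀⟩ := (hQc.fderiv (𝕜 := ℝ)).exists_bound_of_continuous hDc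
  set L := |L₀| + 1 with hLdef
  have hLpos : 0 < L := by positivity
  have hL : ∀ x, ‖fderiv ℝ Q x‖ ≤ L := fun x => by
    have := hL₀ x
    have := le_abs_self L₀
    linarith
  have hdiff : Differentiable ℝ Q := hQ.differentiable one_ne_zero
  have hLip : ∀ x z, Q x - Q z ≤ L * ‖x - z‖ := fun x z =>
    (le_abs_self _).trans (convex_univ.norm_image_sub_le_of_norm_fderiv_le
      (fun y _ => hdiff y) (fun y _ => hL y) (Set.mem_univ z) (Set.mem_univ x))
  have hQe : ∀ x, |Real.exp (Q x)| ≤ Real.exp B := fun x => by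
    rw [Real.abs_exp]
    exact Real.exp_le_exp.mpr (le_of_abs_le (hB x))
  have iA : Integrable fun x => Real.exp (Q x) * Real.exp (-U x) :=
    integrable_continuous_mul (by fun_prop) ⟨_, hQe⟩ hint
  have iD : Integrable fun x => ‖fderiv ℝ Q x‖ ^ 2 * Real.exp (Q x) * Real.exp (-U x) :=
    integrable_continuous_mul (by fun_prop) ⟨L ^ 2 * Real.exp B, fun x => by
      rw [abs_mul, abs_of_nonneg (by positivity)]
      have := hL x
      have := hQe x
      gcongr⟩ hint
  set A := ∫ x, Real.exp (Q x) * Real.exp (-U x) with hA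
  set J := ∫ x, ‖fderiv ℝ Q x‖ ^ 2 * Real.exp (Q x) * Real.exp (-U x) with hJ
  have key : ∀ δ : ℝ, 0 < δ →
      (∫ x, Q x * Real.exp (Q x) * Real.exp (-U x)) - A * Real.log (A / ∫ x, Real.exp (-U x)) ≤
        1 / (2 * ρ) * (J + (2 * L * δ + δ ^ 2) * A) := by
    intro δ hδ
    obtain ⟨r, hr, hrδ⟩ := Metric.uniformContinuous_iff.mp
      ((hQc.fderiv (𝕜 := ℝ)).uniformContinuous_of_continuous hDc) δ hδ
    set S : EuclideanSpace ℝ (Fin n) → ℝ := fun x => (‖fderiv ℝ Q x‖ + δ) ^ 2 / (2 * ρ) with hS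
    have hlocal : ∀ x z, dist x z < r → Q x - Q z ≤ (‖fderiv ℝ Q z‖ + δ) * ‖x - z‖ := by
      intro x z hxz
      refine (le_abs_self _).trans ((convex_ball z r).norm_image_sub_le_of_norm_fderiv_le
        (fun y _ => hdiff y) (fun y hy => ?_) (Metric.mem_ball_self hr) hxz)
      have h1 := (hrδ hy).le
      rw [dist_eq_norm] at h1
      have h2 := norm_le_norm_add_norm_sub' (fderiv ℝ Q y) (fderiv ℝ Q z)
      linarith
    have hstep : ∀ t : ℝ, 0 < t → t < 1 → L / r ≤ ρ * (1 - t) / (2 * t) →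
        (∫ x, Q x * Real.exp (Q x) * Real.exp (-U x)) - A * Real.log (A / ∫ x, Real.exp (-U x)) ≤
        Real.exp (t * ((L + δ) ^ 2 / (2 * ρ)) / (1 - t)) / (1 - t) *
          ∫ x, S x * Real.exp (Q x) * Real.exp (-U x) := by
      intro t ht ht1 hLr
      have hs : 0 < 1 - t := by linarith
      refine entropy_le_of_le_add_sq hU hint hs ht (by ring)
        (fun x y => hconv x y _ _ hs ht (by ring)) hQ.continuous hB (by fun_prop)
        (fun x => by positivity) (fun x => ?_) (fun x z => ?_)
      · have := hL x
        simp only [hS]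
        gcongr
      · rcases lt_or_ge (dist x z) r with hxz | hxz
        · have h1 := hlocal x z hxz
          set a := ‖fderiv ℝ Q z‖ + δ
          set d := ‖x - z‖
          have h2 : t * S z / (1 - t) + ρ * (1 - t) / (2 * t) * d ^ 2 - a * d =
              (t * a - ρ * (1 - t) * d) ^ 2 / (2 * ρ * t * (1 - t)) := by
            have : S z = a ^ 2 / (2 * ρ) := rfl
            rw [this]
            field_simp
            ring
          have h3 : 0 ≤ (t * a - ρ * (1 - t) * d) ^ 2 / (2 * ρ * t * (1 - t)) := by positivity
          linarith
        · have h1 := hLip x z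
          rw [dist_eq_norm] at hxz
          have h2 : L * ‖x - z‖ ≤ L / r * ‖x - z‖ ^ 2 := by
            rw [div_mul_eq_mul_div, le_div_iff₀ hr]
            nlinarith [mul_le_mul_of_nonneg_left hxz (mul_nonneg hLpos.le (norm_nonneg (x - z)))]
          have h3 : L / r * ‖x - z‖ ^ 2 ≤ ρ * (1 - t) / (2 * t) * ‖x - z‖ ^ 2 := by gcongr
          have h4 : 0 ≤ t * S z / (1 - t) := by positivity
          linarith
    have hlim : Filter.Tendsto (fun t : ℝ => Real.exp (t * ((L + δ) ^ 2 / (2 * ρ)) / (1 - t)) /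
        (1 - t) * ∫ x, S x * Real.exp (Q x) * Real.exp (-U x)) (nhdsWithin 0 (Set.Ioi 0))
        (nhds (∫ x, S x * Real.exp (Q x) * Real.exp (-U x))) := by
      have hc : ContinuousAt (fun t : ℝ => Real.exp (t * ((L + δ) ^ 2 / (2 * ρ)) / (1 - t)) /
        (1 - t) * ∫ x, S x * Real.exp (Q x) * Real.exp (-U x)) 0 := by
        refine ContinuousAt.mul (ContinuousAt.div (ContinuousAt.rexp
          (ContinuousAt.div (by fun_prop) (by fun_prop) (by norm_num))) (by fun_prop)
          (by norm_num)) continuousAt_const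
      have := hc.tendsto.mono_left (nhdsWithin_le_nhds (s := Set.Ioi (0 : ℝ)))
      simpa using this
    have hbound : (∫ x, Q x * Real.exp (Q x) * Real.exp (-U x)) -
        A * Real.log (A / ∫ x, Real.exp (-U x)) ≤
        ∫ x, S x * Real.exp (Q x) * Real.exp (-U x) := by
      refine ge_of_tendsto hlim ?_
      set t₀ := ρ / (2 * L / r + ρ) with ht₀
      have ht₀pos : 0 < t₀ := by positivity
      have ht₀1 : t₀ < 1 := by
        rw [ht₀, div_lt_one (by positivity)]
        have : 0 < 2 * L / r := by positivity
        linarith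
      filter_upwards [Ioo_mem_nhdsGT ht₀pos] with t ht
      refine hstep t ht.1 (ht.2.trans ht₀1) ?_
      rw [le_div_iff₀ (by linarith [ht.1])]
      have h1 := ht.2.le
      rw [ht₀, le_div_iff₀ (by positivity)] at h1
      have h2 : L / r * (2 * t) = t * (2 * L / r) := by ring
      rw [h2]
      linarith
    refine hbound.trans ?_
    rw [hJ, hA, ← integral_const_mul, ← integral_add iD (iA.const_mul _), ← integral_const_mul]
    refine integral_mono_of_nonneg (Filter.Eventually.of_forall fun x => by positivity)
      ((iD.add (iA.const_mul _)).const_mul _) (Filter.Eventually.of_forall fun x => ?_)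
    have h1 : S x ≤ 1 / (2 * ρ) * (‖fderiv ℝ Q x‖ ^ 2 + (2 * L * δ + δ ^ 2)) := by
      simp only [hS]
      rw [div_eq_mul_one_div, mul_comm]
      have := hL x
      gcongr
      nlinarith
    calc S x * Real.exp (Q x) * Real.exp (-U x) ≤ 1 / (2 * ρ) *
          (‖fderiv ℝ Q x‖ ^ 2 + (2 * L * δ + δ ^ 2)) * Real.exp (Q x) * Real.exp (-U x) := by
          gcongr
      _ = _ := by ring
  have hlim : Filter.Tendsto (fun δ : ℝ => 1 / (2 * ρ) * (J + (2 * L * δ + δ ^ 2) * A))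
      (nhdsWithin 0 (Set.Ioi 0)) (nhds (1 / (2 * ρ) * J)) := by
    have hc : Continuous fun δ : ℝ => 1 / (2 * ρ) * (J + (2 * L * δ + δ ^ 2) * A) := by fun_prop
    have := (hc.tendsto 0).mono_left (nhdsWithin_le_nhds (s := Set.Ioi (0 : ℝ)))
    simpa using this
  refine ge_of_tendsto hlim ?_
  filter_upwards [self_mem_nhdsWithin] with δ hδ
  exact key δ hδ

lemma le_add_sq_of_neg_le_iteratedFDeriv {E : Type*} [NormedAddCommGroup E]
    [InnerProductSpace ℝ E] {V : E → ℝ} (hV : ContDiff ℝ 2 V) {K : ℝ}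
    (hHess : ∀ x v : E, -(K * ‖v‖ ^ 2) ≤ iteratedFDeriv ℝ 2 V x ![v, v])
    (x y : E) {s t : ℝ} (hs : 0 < s) (ht : 0 < t) (hst : s + t = 1) :
    V (s • x + t • y) ≤ s * V x + t * V y + K * s * t / 2 * ‖x - y‖ ^ 2 := by
  set v := y - x with hv
  have hline : ∀ r : ℝ, HasDerivAt (fun r : ℝ => x + r • v) v r := fun r => by
    simpa using ((hasDerivAt_id r).smul_const v).const_add x
  have h1 : ∀ r : ℝ, HasDerivAt (fun r : ℝ => V (x + r • v) + K * ‖v‖ ^ 2 / 2 * r ^ 2)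
      (fderiv ℝ V (x + r • v) v + K * ‖v‖ ^ 2 * r) r := fun r => by
    have ha := ((hV.differentiable two_ne_zero (x + r • v)).hasFDerivAt).comp_hasDerivAt r (hline r)
    have hb := ((hasDerivAt_id r).pow 2).const_mul (K * ‖v‖ ^ 2 / 2)
    refine (ha.add hb).congr_deriv ?_
    simp
    ring
  have hd : ContDiff ℝ 1 (fderiv ℝ V) := hV.fderiv_right (by norm_num)
  have h2 : ∀ r : ℝ, HasDerivAt (fun r : ℝ => fderiv ℝ V (x + r • v) v + K * ‖v‖ ^ 2 * r)
      (fderiv ℝ (fderiv ℝ V) (x + r • v) v v + K * ‖v‖ ^ 2) r := fun r => by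
    have ha := ((hd.differentiable one_ne_zero (x + r • v)).hasFDerivAt).comp_hasDerivAt r (hline r)
    have hb := (hasDerivAt_id r).const_mul (K * ‖v‖ ^ 2)
    have hc := (ha.clm_apply (hasDerivAt_const r v)).add hb
    refine hc.congr_deriv ?_
    simp
  have hderiv : deriv (fun r : ℝ => V (x + r • v) + K * ‖v‖ ^ 2 / 2 * r ^ 2) =
      fun r : ℝ => fderiv ℝ V (x + r • v) v + K * ‖v‖ ^ 2 * r := funext fun r => (h1 r).deriv
  have hconv := convexOn_of_deriv2_nonneg' (D := Set.univ) convex_univ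
    (f := fun r : ℝ => V (x + r • v) + K * ‖v‖ ^ 2 / 2 * r ^ 2)
    (fun r _ => (h1 r).differentiableAt.differentiableWithinAt)
    (by rw [hderiv]; exact fun r _ => (h2 r).differentiableAt.differentiableWithinAt)
    (fun r _ => by
      rw [Function.iterate_succ, Function.iterate_one, Function.comp_apply, hderiv, (h2 r).deriv]
      have := hHess (x + r • v) v
      rw [iteratedFDeriv_two_apply] at this
      simp only [Matrix.cons_val_zero, Matrix.cons_val_one] at this
      linarith)
  have h3 := hconv.2 (Set.mem_univ 0) (Set.mem_univ 1) hs.le ht.le hst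
  simp only [smul_eq_mul, mul_zero, mul_one, zero_add, zero_smul, add_zero, one_smul] at h3
  have hs' : s = 1 - t := by linarith
  have h4 : s • x + t • y = x + t • v := by rw [hs', hv]; module
  have h5 : x + v = y := by rw [hv]; abel
  rw [h4, norm_sub_rev, ← hv]
  rw [h5] at h3
  subst hs'
  nlinarith

section Gaussian

variable {E : Type*} [NormedAddCommGroup E] [InnerProductSpace ℝ E] [FiniteDimensional ℝ E]
  [MeasurableSpace E] [BorelSpace E]

lemma integrable_exp_neg_mul_norm_sq {b : ℝ} (hb : 0 < b) :
    Integrable fun z : E => Real.exp (-(b * ‖z‖ ^ 2)) := by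
  have h := GaussianFourier.integrable_cexp_neg_mul_sq_norm_add (b := (b : ℂ)) (by simpa using hb)
    0 (0 : E)
  refine h.norm.congr (Filter.Eventually.of_forall fun z => ?_)
  simp [Complex.norm_exp, ← Complex.ofReal_pow]

lemma integrable_exp_neg_mul_norm_sub_sq {b : ℝ} (hb : 0 < b) (x : E) :
    Integrable fun y : E => Real.exp (-(b * ‖x - y‖ ^ 2)) :=
  (integrable_exp_neg_mul_norm_sq hb).comp_sub_left x

lemma integrable_inner_mul_exp_neg_mul_norm_sq {b : ℝ} (hb : 0 < b) (a : E) :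
    Integrable fun z : E => inner ℝ a z * Real.exp (-(b * ‖z‖ ^ 2)) := by
  refine ((integrable_exp_neg_mul_norm_sq (E := E) (half_pos hb)).const_mul
    (‖a‖ * (1 + 2 / b))).mono' (Continuous.aestronglyMeasurable (by fun_prop))
    (Filter.Eventually.of_forall fun z => ?_)
  rw [norm_mul, Real.norm_eq_abs, Real.norm_of_nonneg (Real.exp_pos _).le]
  have h1 := abs_real_inner_le_norm a z
  have h2 : ‖z‖ ≤ (1 + 2 / b) * (b / 2 * ‖z‖ ^ 2 + 1) := by
    have : (1 + 2 / b) * (b / 2 * ‖z‖ ^ 2 + 1) = b / 2 * ‖z‖ ^ 2 + 1 + ‖z‖ ^ 2 + 2 / b := by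
      field_simp
      ring
    rw [this]
    have : 0 < 2 / b := by positivity
    nlinarith [sq_nonneg (‖z‖ - 1), mul_nonneg hb.le (sq_nonneg ‖z‖)]
  have h3 := Real.add_one_le_exp (b / 2 * ‖z‖ ^ 2)
  have h4 : Real.exp (-(b * ‖z‖ ^ 2)) =
      Real.exp (-(b / 2 * ‖z‖ ^ 2)) * Real.exp (-(b / 2 * ‖z‖ ^ 2)) := by
    rw [← Real.exp_add]; congr 1; ring
  have h5 : Real.exp (b / 2 * ‖z‖ ^ 2) * Real.exp (-(b / 2 * ‖z‖ ^ 2)) = 1 := by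
    rw [← Real.exp_add]; simp
  calc |inner ℝ a z| * Real.exp (-(b * ‖z‖ ^ 2))
      ≤ ‖a‖ * ((1 + 2 / b) * Real.exp (b / 2 * ‖z‖ ^ 2)) * Real.exp (-(b * ‖z‖ ^ 2)) := by
        gcongr
        refine h1.trans ?_
        gcongr
        refine h2.trans ?_
        gcongr
    _ = ‖a‖ * (1 + 2 / b) * (Real.exp (b / 2 * ‖z‖ ^ 2) * Real.exp (-(b / 2 * ‖z‖ ^ 2))) *
        Real.exp (-(b / 2 * ‖z‖ ^ 2)) := by rw [h4]; ring
    _ = _ := by rw [h5]; ring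

lemma integral_inner_mul_exp_neg_mul_norm_sq (b : ℝ) (a : E) :
    ∫ z : E, inner ℝ a z * Real.exp (-(b * ‖z‖ ^ 2)) = 0 := by
  have h := integral_neg_eq_self (fun z : E => inner ℝ a z * Real.exp (-(b * ‖z‖ ^ 2))) volume
  simp only [inner_neg_right, norm_neg, neg_mul, integral_neg] at h
  linarith

/-- The Gibbs variational inequality comparing two translates of a Gaussian weight. -/
lemma gaussian_gibbs {κ : ℝ} (hκ : 0 < κ) {l : E → ℝ} (hl : Measurable l) {B : ℝ}
    (hB : ∀ y, |l y| ≤ B) (x x' : E) :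
    (∫ z : E, Real.exp (-(κ / 2 * ‖z‖ ^ 2))) + (∫ y, l y * Real.exp (-(κ / 2 * ‖x - y‖ ^ 2))) -
      (∫ z : E, Real.exp (-(κ / 2 * ‖z‖ ^ 2))) * (κ / 2 * ‖x - x'‖ ^ 2) ≤
      ∫ y, Real.exp (l y) * Real.exp (-(κ / 2 * ‖x' - y‖ ^ 2)) := by
  have hκ2 : 0 < κ / 2 := half_pos hκ
  set c := ∫ z : E, Real.exp (-(κ / 2 * ‖z‖ ^ 2)) with hc
  have hG := integrable_exp_neg_mul_norm_sub_sq hκ2 x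
  have hG' := integrable_exp_neg_mul_norm_sub_sq hκ2 x'
  have hcx : ∫ y, Real.exp (-(κ / 2 * ‖x - y‖ ^ 2)) = c :=
    integral_sub_left_eq_self (fun z : E => Real.exp (-(κ / 2 * ‖z‖ ^ 2))) volume x
  have hI : Integrable fun y => inner ℝ (x' - x) (x - y) * Real.exp (-(κ / 2 * ‖x - y‖ ^ 2)) :=
    (integrable_inner_mul_exp_neg_mul_norm_sq hκ2 (x' - x)).comp_sub_left x
  have hI0 : ∫ y, inner ℝ (x' - x) (x - y) * Real.exp (-(κ / 2 * ‖x - y‖ ^ 2)) = 0 :=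
    (integral_sub_left_eq_self (fun z : E => inner ℝ (x' - x) z *
      Real.exp (-(κ / 2 * ‖z‖ ^ 2))) volume x).trans
      (integral_inner_mul_exp_neg_mul_norm_sq (κ / 2) (x' - x))
  have hlG : Integrable fun y => l y * Real.exp (-(κ / 2 * ‖x - y‖ ^ 2)) :=
    hG.bdd_mul (c := B) hl.aestronglyMeasurable (Filter.Eventually.of_forall hB)
  have hlG' : Integrable fun y => Real.exp (l y) * Real.exp (-(κ / 2 * ‖x' - y‖ ^ 2)) :=
    hG'.bdd_mul (c := Real.exp B) hl.exp.aestronglyMeasurable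
      (Filter.Eventually.of_forall fun y => by
        rw [Real.norm_eq_abs, Real.abs_exp]
        exact Real.exp_le_exp.mpr (le_of_abs_le (hB y)))
  have hsum : Integrable fun y => (1 - κ / 2 * ‖x - x'‖ ^ 2) *
      Real.exp (-(κ / 2 * ‖x - y‖ ^ 2)) + l y * Real.exp (-(κ / 2 * ‖x - y‖ ^ 2)) :=
    (hG.const_mul _).add hlG
  have hsplit : c + (∫ y, l y * Real.exp (-(κ / 2 * ‖x - y‖ ^ 2))) - c * (κ / 2 * ‖x - x'‖ ^ 2) =
      ∫ y, (((1 - κ / 2 * ‖x - x'‖ ^ 2) * Real.exp (-(κ / 2 * ‖x - y‖ ^ 2)) +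
        l y * Real.exp (-(κ / 2 * ‖x - y‖ ^ 2))) -
        κ * (inner ℝ (x' - x) (x - y) * Real.exp (-(κ / 2 * ‖x - y‖ ^ 2)))) := by
    rw [integral_sub hsum (hI.const_mul _),
      integral_add (hG.const_mul _) hlG, integral_const_mul, integral_const_mul, hI0, hcx]
    ring
  rw [hsplit]
  refine integral_mono (hsum.sub (hI.const_mul _)) hlG' fun y => ?_
  have hnorm : ‖x' - y‖ ^ 2 = ‖x - x'‖ ^ 2 + 2 * inner ℝ (x' - x) (x - y) + ‖x - y‖ ^ 2 := by
    have : x' - y = (x' - x) + (x - y) := by abel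
    rw [this, norm_add_sq_real, norm_sub_rev x x']
  set u := l y - κ / 2 * ‖x - x'‖ ^ 2 - κ * inner ℝ (x' - x) (x - y) with hu
  have h1 := Real.add_one_le_exp u
  have h2 : Real.exp (l y) * Real.exp (-(κ / 2 * ‖x' - y‖ ^ 2)) =
      Real.exp u * Real.exp (-(κ / 2 * ‖x - y‖ ^ 2)) := by
    rw [← Real.exp_add, ← Real.exp_add, hnorm, hu]
    congr 1
    ring
  simp only [h2]
  calc _ = (u + 1) * Real.exp (-(κ / 2 * ‖x - y‖ ^ 2)) := by rw [hu]; ring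
    _ ≤ _ := by gcongr

end Gaussian

lemma integrable_exp_neg_mul_norm_sub_sq_of_isFiniteMeasure {E : Type*}
    [NormedAddCommGroup E] [MeasurableSpace E] [BorelSpace E] (μ : Measure E)
    [IsFiniteMeasure μ] {b : ℝ} (hb : 0 < b) (y : E) :
    Integrable (fun x => Real.exp (-(b * ‖x - y‖ ^ 2))) μ := by
  refine (integrable_const (1 : ℝ)).mono' (Continuous.aestronglyMeasurable (by fun_prop))
    (Filter.Eventually.of_forall fun x => ?_)
  rw [Real.norm_eq_abs, Real.abs_exp, Real.exp_le_one_iff]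
  have : 0 ≤ b * ‖x - y‖ ^ 2 := by positivity
  linarith

lemma integral_withDensity_ofReal {X : Type*} [MeasurableSpace X] {μ : Measure X} {p : X → ℝ}
    (hp : Measurable p) (hp0 : ∀ x, 0 ≤ p x) (F : X → ℝ) :
    ∫ x, F x ∂(μ.withDensity fun x => ENNReal.ofReal (p x)) = ∫ x, F x * p x ∂μ := by
  rw [integral_withDensity_eq_integral_toReal_smul (f := fun x => ENNReal.ofReal (p x))
    hp.ennreal_ofReal
    (Filter.Eventually.of_forall fun x => ENNReal.ofReal_lt_top)]
  refine integral_congr_ae (Filter.Eventually.of_forall fun x => ?_)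
  simp [ENNReal.toReal_ofReal (hp0 x), mul_comm]

/-- Bounds for averages of a function against a Gaussian weight. -/
lemma gaussian_average_mem_Icc {E : Type*} [NormedAddCommGroup E] [MeasurableSpace E]
    [BorelSpace E] {μ : Measure E} [IsProbabilityMeasure μ] {b : ℝ} (hb : 0 < b) {p : E → ℝ}
    (hp : Continuous p) {l u : ℝ} (hl : ∀ x, l ≤ p x) (hu : ∀ x, p x ≤ u) (y : E) :
    0 < ∫ x, Real.exp (-(b * ‖x - y‖ ^ 2)) ∂μ ∧
    (∫ x, p x * Real.exp (-(b * ‖x - y‖ ^ 2)) ∂μ) / (∫ x, Real.exp (-(b * ‖x - y‖ ^ 2)) ∂μ) ∈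
      Set.Icc l u := by
  have hG := integrable_exp_neg_mul_norm_sub_sq_of_isFiniteMeasure μ hb y
  have hpG : Integrable (fun x => p x * Real.exp (-(b * ‖x - y‖ ^ 2))) μ :=
    integrable_continuous_mul hp ⟨max |l| |u|, fun x => abs_le_max_abs_abs (hl x) (hu x)⟩ hG
  have hpos : 0 < ∫ x, Real.exp (-(b * ‖x - y‖ ^ 2)) ∂μ := integral_exp_pos hG
  refine ⟨hpos, ?_, ?_⟩
  · rw [le_div_iff₀ hpos, ← integral_const_mul]
    refine integral_mono (hG.const_mul _) hpG fun x => ?_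
    exact mul_le_mul_of_nonneg_right (hl x) (Real.exp_pos _).le
  · rw [div_le_iff₀ hpos, ← integral_const_mul]
    refine integral_mono hpG (hG.const_mul _) fun x => ?_
    exact mul_le_mul_of_nonneg_right (hu x) (Real.exp_pos _).le

section GaussianKernel

variable {E : Type*} [NormedAddCommGroup E] [InnerProductSpace ℝ E] [FiniteDimensional ℝ E]
  [MeasurableSpace E] [BorelSpace E]

lemma integral_exp_neg_mul_norm_sub_sq (b : ℝ) (x : E) :
    ∫ y : E, Real.exp (-(b * ‖x - y‖ ^ 2)) = ∫ z : E, Real.exp (-(b * ‖z‖ ^ 2)) :=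
  integral_sub_left_eq_self (fun z : E => Real.exp (-(b * ‖z‖ ^ 2))) volume x

lemma integrable_gaussianKernel_prod {μ : Measure E} [IsFiniteMeasure μ] {b : ℝ} (hb : 0 < b) :
    Integrable (fun q : E × E => Real.exp (-(b * ‖q.1 - q.2‖ ^ 2))) (μ.prod volume) := by
  rw [integrable_prod_iff (Continuous.aestronglyMeasurable (by fun_prop))]
  refine ⟨Filter.Eventually.of_forall fun x => integrable_exp_neg_mul_norm_sub_sq hb x, ?_⟩
  simp only [Real.norm_eq_abs, Real.abs_exp, integral_exp_neg_mul_norm_sub_sq]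
  exact integrable_const _

lemma integrable_mul_gaussianKernel_prod {μ : Measure E} [IsFiniteMeasure μ] {b : ℝ}
    (hb : 0 < b) {F : E × E → ℝ} (hF : Measurable F) {C : ℝ} (hC : ∀ q, |F q| ≤ C) :
    Integrable (fun q : E × E => F q * Real.exp (-(b * ‖q.1 - q.2‖ ^ 2))) (μ.prod volume) :=
  (integrable_gaussianKernel_prod hb).bdd_mul (c := C) hF.aestronglyMeasurable
    (Filter.Eventually.of_forall hC)

lemma integral_integral_mul_gaussianKernel {μ : Measure E} [IsFiniteMeasure μ] {b : ℝ}
    (hb : 0 < b) {F : E → ℝ} (hF : Continuous F) {C : ℝ} (hC : ∀ x, |F x| ≤ C) :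
    ∫ y, ∫ x, F x * Real.exp (-(b * ‖x - y‖ ^ 2)) ∂μ =
      (∫ z : E, Real.exp (-(b * ‖z‖ ^ 2))) * ∫ x, F x ∂μ := by
  rw [← integral_integral_swap (f := fun x y => F x * Real.exp (-(b * ‖x - y‖ ^ 2)))
    (integrable_mul_gaussianKernel_prod hb (F := fun q => F q.1)
      (hF.measurable.comp measurable_fst) fun q => hC q.1), mul_comm, ← integral_mul_const]
  simp_rw [integral_const_mul, integral_exp_neg_mul_norm_sub_sq]

lemma measurable_gaussian_average {μ : Measure E} [IsProbabilityMeasure μ] (b : ℝ)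
    {p : E → ℝ} (hp : Continuous p) :
    Measurable fun y => ∫ x, p x * Real.exp (-(b * ‖x - y‖ ^ 2)) ∂μ :=
  (StronglyMeasurable.integral_prod_left (f := fun x y => p x * Real.exp (-(b * ‖x - y‖ ^ 2)))
    (Continuous.stronglyMeasurable (by unfold Function.uncurry; fun_prop))).measurable

/-- After Gaussian convolution, the relative entropy of `pμ` with respect to `μ` is bounded by the
quadratic transport cost of any coupling. -/
lemma gaussian_entropy_le_transport {μ : Measure E} [IsProbabilityMeasure μ] {p : E → ℝ}
    (hp : Continuous p) {a b : ℝ} (ha : 0 < a) (hpa : ∀ x, a ≤ p x) (hpb : ∀ x, p x ≤ b)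
    (hp1 : ∫ x, p x ∂μ = 1) {π : Measure (E × E)}
    (hπ₁ : π.map Prod.fst = μ.withDensity fun x => ENNReal.ofReal (p x))
    (hπ₂ : π.map Prod.snd = μ) (hD : Integrable (fun q : E × E => ‖q.1 - q.2‖ ^ 2) π)
    {κ : ℝ} (hκ : 0 < κ) :
    ∫ y, (∫ x, p x * Real.exp (-(κ / 2 * ‖x - y‖ ^ 2)) ∂μ) *
        Real.log ((∫ x, p x * Real.exp (-(κ / 2 * ‖x - y‖ ^ 2)) ∂μ) /
          ∫ x, Real.exp (-(κ / 2 * ‖x - y‖ ^ 2)) ∂μ) ≤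
      (∫ z : E, Real.exp (-(κ / 2 * ‖z‖ ^ 2))) * (κ / 2 * ∫ q, ‖q.1 - q.2‖ ^ 2 ∂π) := by
  have hκ2 : 0 < κ / 2 := half_pos hκ
  have hp0 : ∀ x, 0 ≤ p x := fun x => ha.le.trans (hpa x)
  have hπprob : IsProbabilityMeasure π := ⟨by
    rw [← Set.preimage_univ (f := Prod.snd), ← Measure.map_apply measurable_snd MeasurableSet.univ,
      hπ₂, measure_univ]⟩
  set c := ∫ z : E, Real.exp (-(κ / 2 * ‖z‖ ^ 2)) with hc
  set N : E → ℝ := fun y => ∫ x, p x * Real.exp (-(κ / 2 * ‖x - y‖ ^ 2)) ∂μ with hN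
  set M : E → ℝ := fun y => ∫ x, Real.exp (-(κ / 2 * ‖x - y‖ ^ 2)) ∂μ with hM
  have hNm : Measurable N := measurable_gaussian_average (κ / 2) hp
  have hMm : Measurable M := by
    have := measurable_gaussian_average (μ := μ) (κ / 2) (p := fun _ : E => (1 : ℝ))
      continuous_const
    simpa [hM] using this
  have hNM : ∀ y, 0 < M y ∧ N y / M y ∈ Set.Icc a b :=
    gaussian_average_mem_Icc hκ2 hp hpa hpb
  have hNMpos : ∀ y, 0 < N y / M y := fun y => ha.trans_le (hNM y).2.1
  set l : E → ℝ := fun y => Real.log (N y / M y) with hl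
  have hlm : Measurable l := (hNm.div hMm).log
  set B := max |Real.log a| |Real.log b| with hB
  have hlB : ∀ y, |l y| ≤ B := fun y => abs_le_max_abs_abs
    (Real.log_le_log ha (hNM y).2.1) (Real.log_le_log (hNMpos y) (hNM y).2.2)
  have hel : ∀ y, Real.exp (l y) = N y / M y := fun y => Real.exp_log (hNMpos y)
  have helB : ∀ y, |Real.exp (l y)| ≤ b := fun y => by
    rw [Real.abs_exp, hel]; exact (hNM y).2.2
  have hpabs : ∀ x, |p x| ≤ b := fun x => by rw [abs_of_nonneg (hp0 x)]; exact hpb x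
  set Φ : E → ℝ := fun x => ∫ y, l y * Real.exp (-(κ / 2 * ‖x - y‖ ^ 2)) with hΦ
  set Ψ : E → ℝ := fun x => ∫ y, Real.exp (l y) * Real.exp (-(κ / 2 * ‖x - y‖ ^ 2)) with hΨ
  have hmeas : ∀ f : E → ℝ, Measurable f →
      Measurable fun x => ∫ y, f y * Real.exp (-(κ / 2 * ‖x - y‖ ^ 2)) := fun f hf =>
    (StronglyMeasurable.integral_prod_right
      (f := fun x y => f y * Real.exp (-(κ / 2 * ‖x - y‖ ^ 2)))
      (Measurable.stronglyMeasurable (by unfold Function.uncurry; fun_prop))).measurable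
  have hbound : ∀ (f : E → ℝ) (C : ℝ), (∀ y, |f y| ≤ C) →
      ∀ x, ‖∫ y, f y * Real.exp (-(κ / 2 * ‖x - y‖ ^ 2))‖ ≤ C * c := by
    intro f C hfC x
    rw [hc, ← integral_exp_neg_mul_norm_sub_sq (κ / 2) x, ← integral_const_mul]
    refine norm_integral_le_of_norm_le ((integrable_exp_neg_mul_norm_sub_sq hκ2 x).const_mul C)
      (Filter.Eventually.of_forall fun y => ?_)
    rw [norm_mul, Real.norm_of_nonneg (Real.exp_pos _).le]
    exact mul_le_mul_of_nonneg_right (hfC y) (Real.exp_pos _).le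
  have iΦ : Integrable (fun q : E × E => Φ q.1) π :=
    (integrable_const (B * c)).mono' ((hmeas l hlm).comp measurable_fst).aestronglyMeasurable
      (Filter.Eventually.of_forall fun q => hbound l B hlB q.1)
  have iΨ : Integrable (fun q : E × E => Ψ q.2) π :=
    (integrable_const (b * c)).mono'
      ((hmeas _ hlm.exp).comp measurable_snd).aestronglyMeasurable
      (Filter.Eventually.of_forall fun q => hbound _ b helB q.2)
  have hΦint : ∫ q, Φ q.1 ∂π = ∫ y, N y * l y := by
    rw [← integral_map (f := Φ) measurable_fst.aemeasurable (hmeas l hlm).aestronglyMeasurable,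
      hπ₁, integral_withDensity_ofReal hp.measurable hp0]
    simp_rw [hΦ, ← integral_mul_const]
    rw [integral_integral_swap (f := fun x y => l y * Real.exp (-(κ / 2 * ‖x - y‖ ^ 2)) * p x)]
    · refine integral_congr_ae (Filter.Eventually.of_forall fun y => ?_)
      simp only [hN]
      rw [← integral_mul_const]
      refine integral_congr_ae (Filter.Eventually.of_forall fun x => ?_)
      ring
    · refine (integrable_mul_gaussianKernel_prod hκ2 (F := fun q : E × E => l q.2 * p q.1)
        (C := B * b) (by fun_prop) fun q => ?_).congr (Filter.Eventually.of_forall fun q => ?_)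
      · rw [abs_mul]
        exact mul_le_mul (hlB _) (hpabs _) (abs_nonneg _) ((abs_nonneg _).trans (hlB q.2))
      · simp only [Function.uncurry]
        ring
  have hΨint : ∫ q, Ψ q.2 ∂π = c := by
    rw [← integral_map (f := Ψ) measurable_snd.aemeasurable (hmeas _ hlm.exp).aestronglyMeasurable,
      hπ₂]
    simp_rw [hΨ]
    rw [integral_integral_swap (f := fun x y => Real.exp (l y) *
      Real.exp (-(κ / 2 * ‖x - y‖ ^ 2))) (integrable_mul_gaussianKernel_prod hκ2
        (F := fun q : E × E => Real.exp (l q.2)) (C := b) (by fun_prop) fun q => helB q.2)]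
    simp_rw [integral_const_mul, hel]
    calc ∫ y, N y / M y * M y = ∫ y, N y := by
          refine integral_congr_ae (Filter.Eventually.of_forall fun y => ?_)
          exact div_mul_cancel₀ _ (hNM y).1.ne'
      _ = c := by rw [hN, integral_integral_mul_gaussianKernel hκ2 hp hpabs, hp1, mul_one]
  have hcc : Integrable (fun _ : E × E => c) π := integrable_const c
  have hcΦ : Integrable (fun q : E × E => c + Φ q.1) π := hcc.add iΦ
  have hDc : Integrable (fun q : E × E => c * (κ / 2 * ‖q.1 - q.2‖ ^ 2)) π :=
    (hD.const_mul _).const_mul _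
  have key : ∫ q, (c + Φ q.1 - c * (κ / 2 * ‖q.1 - q.2‖ ^ 2)) ∂π ≤ ∫ q, Ψ q.2 ∂π :=
    integral_mono (hcΦ.sub hDc) iΨ fun q => gaussian_gibbs hκ hlm hlB q.1 q.2
  rw [integral_sub hcΦ hDc, integral_add hcc iΦ, integral_const_mul, integral_const_mul, hΦint,
    hΨint, integral_const, probReal_univ, one_smul] at key
  linarith

end GaussianKernel

/-- An HWI-type inequality: entropy is bounded by transport cost and Fisher information for
measures `e^{-U}` with `U` semiconvex. -/
lemma entropy_le_transport_add_fisher {n : ℕ} {U : EuclideanSpace ℝ (Fin n) → ℝ}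
    (hU : Continuous U) {μ : Measure (EuclideanSpace ℝ (Fin n))} [IsProbabilityMeasure μ]
    (hμ : μ = volume.withDensity fun x => ENNReal.ofReal (Real.exp (-U x))) {K : ℝ}
    (hconv : ∀ x y (s t : ℝ), 0 < s → 0 < t → s + t = 1 →
      U (s • x + t • y) ≤ s * U x + t * U y + K * s * t / 2 * ‖x - y‖ ^ 2)
    {Q : EuclideanSpace ℝ (Fin n) → ℝ} (hQ : ContDiff ℝ 1 Q) (hQc : HasCompactSupport Q)
    {π : Measure (EuclideanSpace ℝ (Fin n) × EuclideanSpace ℝ (Fin n))}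
    (hπ₁ : π.map Prod.fst = μ.withDensity fun x =>
      ENNReal.ofReal (Real.exp (Q x) / ∫ x, Real.exp (Q x) ∂μ))
    (hπ₂ : π.map Prod.snd = μ) (hD : Integrable (fun q => ‖q.1 - q.2‖ ^ 2) π)
    {κ : ℝ} (hκ : 0 < κ) (hκK : K < κ) :
    (∫ x, Q x * Real.exp (Q x) ∂μ) -
        (∫ x, Real.exp (Q x) ∂μ) * Real.log (∫ x, Real.exp (Q x) ∂μ) ≤
      (∫ x, Real.exp (Q x) ∂μ) * (κ / 2 * ∫ q, ‖q.1 - q.2‖ ^ 2 ∂π) +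
        1 / (2 * (κ - K)) * ∫ x, ‖fderiv ℝ Q x‖ ^ 2 * Real.exp (Q x) ∂μ := by
  have hκ2 : 0 < κ / 2 := half_pos hκ
  obtain ⟨B, hB⟩ := hQc.exists_bound_of_continuous hQ.continuous
  have hDQ : Continuous (fderiv ℝ Q) := hQ.continuous_fderiv one_ne_zero
  obtain ⟨L, hL⟩ := (hQc.fderiv (𝕜 := ℝ)).exists_bound_of_continuous hDQ
  have hQcont := hQ.continuous
  have hQe : ∀ x, |Real.exp (Q x)| ≤ Real.exp B := fun x => by
    rw [Real.abs_exp]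
    exact Real.exp_le_exp.mpr (le_of_abs_le (hB x))
  have hQel : ∀ x, Real.exp (-B) ≤ Real.exp (Q x) := fun x =>
    Real.exp_le_exp.mpr (neg_le_of_abs_le (hB x))
  have hQQ : ∀ x, |Q x * Real.exp (Q x)| ≤ B * Real.exp B := fun x => by
    rw [abs_mul]
    exact mul_le_mul (hB x) (hQe x) (abs_nonneg _) ((abs_nonneg _).trans (hB x))
  have hDD : ∀ x, |‖fderiv ℝ Q x‖ ^ 2 * Real.exp (Q x)| ≤ L ^ 2 * Real.exp B := fun x => by
    rw [abs_mul, abs_of_nonneg (by positivity)]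
    have := hL x
    have := hQe x
    gcongr
  have hconvμ : ∀ F : EuclideanSpace ℝ (Fin n) → ℝ, ∫ x, F x ∂μ = ∫ x, F x * Real.exp (-U x) := by
    intro F
    rw [hμ]
    exact integral_withDensity_ofReal (by fun_prop) (fun x => (Real.exp_pos _).le) F
  have hUint : Integrable fun x => Real.exp (-U x) := by
    refine ⟨Continuous.aestronglyMeasurable (by fun_prop), ?_⟩
    rw [hasFiniteIntegral_iff_ofReal (Filter.Eventually.of_forall fun x => (Real.exp_pos _).le)]
    have h1 : μ Set.univ = 1 := measure_univ
    rw [hμ, withDensity_apply _ MeasurableSet.univ, Measure.restrict_univ] at h1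
    rw [h1]
    exact one_lt_top
  have iexp : Integrable (fun x => Real.exp (Q x)) μ :=
    (integrable_const (Real.exp B)).mono' (Continuous.aestronglyMeasurable (by fun_prop))
      (Filter.Eventually.of_forall hQe)
  set m := ∫ x, Real.exp (Q x) ∂μ with hm
  have hmpos : 0 < m := integral_exp_pos iexp
  set c := ∫ z : EuclideanSpace ℝ (Fin n), Real.exp (-(κ / 2 * ‖z‖ ^ 2)) with hc
  have hcpos : 0 < c := integral_exp_pos (integrable_exp_neg_mul_norm_sq hκ2)
  set G : EuclideanSpace ℝ (Fin n) → EuclideanSpace ℝ (Fin n) → ℝ :=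
    fun x y => Real.exp (-(κ / 2 * ‖x - y‖ ^ 2)) with hG
  set p : EuclideanSpace ℝ (Fin n) → ℝ := fun x => Real.exp (Q x) / m with hp
  have hpc : Continuous p := by fun_prop
  have htrans := gaussian_entropy_le_transport hpc (a := Real.exp (-B) / m)
    (b := Real.exp B / m) (by positivity)
    (fun x => div_le_div_of_nonneg_right (hQel x) hmpos.le)
    (fun x => div_le_div_of_nonneg_right ((le_abs_self _).trans (hQe x)) hmpos.le)
    (by rw [hp, integral_div, ← hm, div_self hmpos.ne']) hπ₁ hπ₂ hD hκ
  have hNp : ∀ y, ∫ x, p x * G x y ∂μ = (∫ x, Real.exp (Q x) * G x y ∂μ) / m := by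
    intro y
    rw [← integral_div]
    refine integral_congr_ae (Filter.Eventually.of_forall fun x => ?_)
    simp only [hp]
    ring
  set N : EuclideanSpace ℝ (Fin n) → ℝ := fun y => ∫ x, Real.exp (Q x) * G x y ∂μ with hN
  set M : EuclideanSpace ℝ (Fin n) → ℝ := fun y => ∫ x, G x y ∂μ with hM
  have hNM : ∀ y, 0 < M y ∧ N y / M y ∈ Set.Icc (Real.exp (-B)) (Real.exp B) :=
    gaussian_average_mem_Icc hκ2 hQcont.rexp hQel fun x => (le_abs_self _).trans (hQe x)
  have hNMpos : ∀ y, 0 < N y / M y := fun y => (Real.exp_pos _).trans_le (hNM y).2.1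
  have hcond : ∀ y, (∫ x, Q x * Real.exp (Q x) * G x y ∂μ) - N y * Real.log (N y / M y) ≤
      1 / (2 * (κ - K)) * ∫ x, ‖fderiv ℝ Q x‖ ^ 2 * Real.exp (Q x) * G x y ∂μ := by
    intro y
    have hexp : ∀ x, Real.exp (-(U x + κ / 2 * ‖x - y‖ ^ 2)) = G x y * Real.exp (-U x) := by
      intro x
      rw [neg_add, Real.exp_add, mul_comm]
    have h := logSobolev_of_stronglyConvex (U := fun x => U x + κ / 2 * ‖x - y‖ ^ 2)
      (by fun_prop) (by
        simp_rw [hexp]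
        refine integrable_continuous_mul (by fun_prop) ⟨1, fun x => ?_⟩ hUint
        simp only [hG, Real.abs_exp, Real.exp_le_one_iff]
        have : 0 ≤ κ / 2 * ‖x - y‖ ^ 2 := by positivity
        linarith) (ρ := κ - K) (by linarith) (fun x x' s t hs ht hst => by
        have h1 := hconv x x' s t hs ht hst
        have h2 : ‖s • x + t • x' - y‖ ^ 2 =
            s * ‖x - y‖ ^ 2 + t * ‖x' - y‖ ^ 2 - s * t * ‖x - x'‖ ^ 2 := by
          have h3 : s • x + t • x' - y = s • (x - y) + t • (x' - y) := by
            have : s = 1 - t := by linarith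
            subst this
            module
          have h4 : x - x' = (x - y) - (x' - y) := by abel
          rw [h3, h4, norm_add_sq_real, norm_sub_sq_real (x - y) (x' - y), norm_smul, norm_smul,
            Real.norm_of_nonneg hs.le, Real.norm_of_nonneg ht.le, inner_smul_left,
            inner_smul_right]
          have : s = 1 - t := by linarith
          subst this
          simp only [conj_trivial]
          ring
        simp only [h2]
        nlinarith) hQ hQc
    simp only [hexp, ← mul_assoc] at h
    simpa only [← hconvμ] using h
  have iQG : Integrable fun y => ∫ x, Q x * Real.exp (Q x) * G x y ∂μ :=
    (integrable_mul_gaussianKernel_prod hκ2 (μ := μ) (F := fun q => Q q.1 * Real.exp (Q q.1))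
      (by fun_prop) fun q => hQQ q.1).integral_prod_right
  have iDG : Integrable fun y => ∫ x, ‖fderiv ℝ Q x‖ ^ 2 * Real.exp (Q x) * G x y ∂μ :=
    (integrable_mul_gaussianKernel_prod hκ2 (μ := μ)
      (F := fun q => ‖fderiv ℝ Q q.1‖ ^ 2 * Real.exp (Q q.1))
      (Continuous.measurable (by fun_prop)) fun q => hDD q.1).integral_prod_right
  have iN : Integrable N :=
    (integrable_mul_gaussianKernel_prod hκ2 (μ := μ) (F := fun q => Real.exp (Q q.1))
      (by fun_prop) fun q => hQe q.1).integral_prod_right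
  have hNm : Measurable N := measurable_gaussian_average (κ / 2) hQcont.rexp
  have hMm : Measurable M := by
    have := measurable_gaussian_average (μ := μ) (κ / 2)
      (p := fun _ : EuclideanSpace ℝ (Fin n) => (1 : ℝ)) continuous_const
    simpa [hM, hG] using this
  have iNl : Integrable fun y => N y * Real.log (N y / M y) := by
    refine iN.mul_bdd (c := B) (hNm.div hMm).log.aestronglyMeasurable
      (Filter.Eventually.of_forall fun y => abs_le.mpr ⟨?_, ?_⟩)
    · rw [Real.le_log_iff_exp_le (hNMpos y)]
      exact (hNM y).2.1
    · rw [Real.log_le_iff_le_exp (hNMpos y)]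
      exact (hNM y).2.2
  have hNint : ∫ y, N y = c * m :=
    integral_integral_mul_gaussianKernel hκ2 hQcont.rexp hQe
  have htotal := integral_mono (iQG.sub iNl) (iDG.const_mul (1 / (2 * (κ - K)))) hcond
  simp only [Pi.sub_apply] at htotal
  rw [integral_sub iQG iNl, integral_const_mul,
    integral_integral_mul_gaussianKernel hκ2 (by fun_prop) hQQ,
    integral_integral_mul_gaussianKernel hκ2 (by fun_prop) hDD] at htotal
  have hsplit : ∫ y, N y * Real.log (N y / M y) =
      m * (∫ y, (∫ x, p x * G x y ∂μ) * Real.log ((∫ x, p x * G x y ∂μ) / M y)) +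
        c * m * Real.log m := by
    have h1 : ∀ y, m * ((∫ x, p x * G x y ∂μ) * Real.log ((∫ x, p x * G x y ∂μ) / M y)) =
        N y * Real.log (N y / M y) - N y * Real.log m := by
      intro y
      rw [hNp y]
      change m * (N y / m * Real.log (N y / m / M y)) = _
      rw [div_right_comm, Real.log_div (hNMpos y).ne' hmpos.ne']
      field_simp
    rw [← integral_const_mul]
    simp_rw [h1]
    rw [integral_sub iNl (iN.mul_const _), integral_mul_const, hNint]
    ring
  rw [hsplit] at htotal
  have h2 : m * ∫ y, (∫ x, p x * G x y ∂μ) * Real.log ((∫ x, p x * G x y ∂μ) / M y) ≤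
      m * (c * (κ / 2 * ∫ q, ‖q.1 - q.2‖ ^ 2 ∂π)) := mul_le_mul_of_nonneg_left htrans hmpos.le
  have h3 : c * ((∫ x, Q x * Real.exp (Q x) ∂μ) - m * Real.log m) ≤
      c * (m * (κ / 2 * ∫ q, ‖q.1 - q.2‖ ^ 2 ∂π) +
        1 / (2 * (κ - K)) * ∫ x, ‖fderiv ℝ Q x‖ ^ 2 * Real.exp (Q x) ∂μ) := by
    linarith
  exact le_of_mul_le_mul_left h3 hcpos

lemma norm_gradient_eq_norm_fderiv {E : Type*} [NormedAddCommGroup E] [InnerProductSpace ℝ E]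
    [CompleteSpace E] (f : E → ℝ) (x : E) : ‖gradient f x‖ = ‖fderiv ℝ f x‖ := by
  rw [gradient, LinearIsometryEquiv.norm_map]

lemma lintegral_nnnorm_gradient_sq {n : ℕ} (f : EuclideanSpace ℝ (Fin n) → ℝ)
    (μ : Measure (EuclideanSpace ℝ (Fin n))) :
    ∫⁻ x, (‖gradient f x‖₊ : ℝ≥0∞) ^ 2 ∂μ = ∫⁻ x, ENNReal.ofReal (‖fderiv ℝ f x‖ ^ 2) ∂μ := by
  refine lintegral_congr fun x => ?_
  rw [ENNReal.ofReal_pow (norm_nonneg _), ← norm_gradient_eq_norm_fderiv, ofReal_norm,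
    enorm_eq_nnnorm]

lemma norm_fderiv_sqrt_exp_div {E : Type*} [NormedAddCommGroup E] [NormedSpace ℝ E] {Q : E → ℝ}
    (hQ : Differentiable ℝ Q) {m : ℝ} (hm : 0 < m) :
    Differentiable ℝ (fun x => Real.sqrt (Real.exp (Q x) / m)) ∧
    ∀ x, ‖fderiv ℝ (fun x => Real.sqrt (Real.exp (Q x) / m)) x‖ ^ 2 =
      1 / (4 * m) * (‖fderiv ℝ Q x‖ ^ 2 * Real.exp (Q x)) := by
  have hd : ∀ x, HasFDerivAt (fun x => Real.sqrt (Real.exp (Q x) / m))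
      ((1 / (2 * Real.sqrt (Real.exp (Q x) / m)) * (Real.exp (Q x) / m)) • fderiv ℝ Q x) x := by
    intro x
    have h1 : HasFDerivAt (fun x => Real.exp (Q x) / m)
        ((Real.exp (Q x) / m) • fderiv ℝ Q x) x := by
      refine ((hQ x).hasFDerivAt.exp.mul_const m⁻¹).congr_fderiv ?_
      rw [smul_smul, mul_comm, div_eq_mul_inv]
    refine (h1.sqrt (by positivity)).congr_fderiv ?_
    rw [smul_smul]
  refine ⟨fun x => (hd x).differentiableAt, fun x => ?_⟩
  rw [(hd x).fderiv, norm_smul, mul_pow, Real.norm_eq_abs, sq_abs, mul_pow, div_pow, mul_pow,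
    Real.sq_sqrt (by positivity)]
  have := Real.exp_pos (Q x)
  field_simp
  ring

lemma fisherInfo_exp_le {n : ℕ} {μ : Measure (EuclideanSpace ℝ (Fin n))}
    {Q : EuclideanSpace ℝ (Fin n) → ℝ} (hQ : Differentiable ℝ Q) {m : ℝ} (hm : 0 < m)
    (hI : Integrable (fun x => ‖fderiv ℝ Q x‖ ^ 2 * Real.exp (Q x)) μ) :
    fisherInfo (μ.withDensity fun x => ENNReal.ofReal (Real.exp (Q x) / m)) μ ≤
      ENNReal.ofReal (1 / (4 * m) * ∫ x, ‖fderiv ℝ Q x‖ ^ 2 * Real.exp (Q x) ∂μ) := by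
  obtain ⟨hd, hn⟩ := norm_fderiv_sqrt_exp_div hQ hm
  refine iInf_le_of_le (fun x => Real.exp (Q x) / m) <| iInf_le_of_le (fun x => by positivity) <|
    iInf_le_of_le rfl <| iInf_le_of_le hd ?_
  rw [lintegral_nnnorm_gradient_sq]
  simp_rw [hn]
  rw [← integral_const_mul, ofReal_integral_eq_lintegral_ofReal (hI.const_mul _)
    (Filter.Eventually.of_forall fun x => by positivity)]

lemma exists_coupling_of_wassersteinDist_two_le {n : ℕ}
    {ν μ : Measure (EuclideanSpace ℝ (Fin n))} {a : ℝ} (ha : 0 ≤ a)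
    (h : wassersteinDist 2 ν μ ≤ ENNReal.ofReal a) {δ : ℝ} (hδ : 0 < δ) :
    ∃ π, IsCoupling π ν μ ∧ Integrable (fun q => ‖q.1 - q.2‖ ^ 2) π ∧
      ∫ q, ‖q.1 - q.2‖ ^ 2 ∂π ≤ a ^ 2 + δ := by
  have h1 : (⨅ (π : Measure (EuclideanSpace ℝ (Fin n) × EuclideanSpace ℝ (Fin n)))
      (_ : IsCoupling π ν μ), ∫⁻ q, edist q.1 q.2 ^ (2 : ℝ) ∂π) < ENNReal.ofReal (a ^ 2 + δ) := by
    have h2 := ENNReal.rpow_le_rpow h (zero_le_two (α := ℝ))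
    rw [wassersteinDist, ← ENNReal.rpow_mul, one_div_mul_cancel two_ne_zero, ENNReal.rpow_one,
      ENNReal.rpow_two, ← ENNReal.ofReal_pow ha] at h2
    exact h2.trans_lt ((ENNReal.ofReal_lt_ofReal_iff (by positivity)).mpr (by linarith))
  simp only [iInf_lt_iff] at h1
  obtain ⟨π, hπ, hlt⟩ := h1
  have hcongr : ∫⁻ q, edist q.1 q.2 ^ (2 : ℝ) ∂π = ∫⁻ q, ENNReal.ofReal (‖q.1 - q.2‖ ^ 2) ∂π := by
    refine lintegral_congr fun q => ?_
    rw [edist_dist, dist_eq_norm, ENNReal.rpow_two, ENNReal.ofReal_pow (norm_nonneg _)]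
  rw [hcongr] at hlt
  have hint : Integrable (fun q => ‖q.1 - q.2‖ ^ 2) π := by
    refine ⟨Continuous.aestronglyMeasurable (by fun_prop), ?_⟩
    rw [hasFiniteIntegral_iff_ofReal (Filter.Eventually.of_forall fun q => by positivity)]
    exact hlt.trans ofReal_lt_top
  refine ⟨π, hπ, hint, ?_⟩
  rw [← ofReal_integral_eq_lintegral_ofReal hint
    (Filter.Eventually.of_forall fun q => by positivity)] at hlt
  exact (ENNReal.ofReal_lt_ofReal_iff (by positivity)).mp hlt |>.le

lemma genInv_nonneg (α : ℝ → ℝ) (s : ℝ) : 0 ≤ genInv α s :=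
  Real.sInf_nonneg fun _ hr => hr.1

lemma wassersteinDist_le_genInv {n : ℕ} {ν μ : Measure (EuclideanSpace ℝ (Fin n))} {α : ℝ → ℝ}
    (hα : ∀ r : ℝ, 0 ≤ r → ENNReal.ofReal r ≤ wassersteinDist 2 ν μ →
      ENNReal.ofReal (α r) ≤ fisherInfo ν μ) {s : ℝ} (hs : 0 < s)
    (hne : {r : ℝ | 0 ≤ r ∧ s < α r}.Nonempty) (hI : fisherInfo ν μ < ENNReal.ofReal s) :
    wassersteinDist 2 ν μ ≤ ENNReal.ofReal (genInv α s) := by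
  have hlt : ∀ r ∈ {r : ℝ | 0 ≤ r ∧ s < α r}, wassersteinDist 2 ν μ < ENNReal.ofReal r := by
    intro r hr
    by_contra! hle
    have h1 := (hα r hr.1 hle).trans_lt hI
    rw [ENNReal.ofReal_lt_ofReal_iff hs] at h1
    exact h1.not_gt hr.2
  obtain ⟨r₀, hr₀⟩ := hne
  have hfin : wassersteinDist 2 ν μ ≠ ⊤ := (hlt r₀ hr₀).ne_top
  rw [← ENNReal.ofReal_toReal hfin]
  refine ENNReal.ofReal_le_ofReal (le_csInf ⟨r₀, hr₀⟩ fun r hr => ?_)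
  exact ENNReal.toReal_le_of_le_ofReal hr.1 (hlt r hr).le

lemma betaOf_le {α : ℝ → ℝ} {K H s : ℝ} (hs : 0 < s)
    (h : {r : ℝ | 0 ≤ r ∧ s < α r}.Nonempty →
      H ≤ 2 * Real.sqrt (2 * s) * genInv α s + K * genInv α s ^ 2) (hH : 0 < H) :
    betaOf α K H ≤ s := by
  have hbdd : BddBelow {s : ℝ | 0 < s ∧
      H ≤ 2 * Real.sqrt (2 * s) * genInv α s + K * genInv α s ^ 2} := ⟨0, fun _ hr => hr.1.le⟩
  by_cases hne : {r : ℝ | 0 ≤ r ∧ s < α r}.Nonempty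
  · exact csInf_le hbdd ⟨hs, h hne⟩
  · rcases Set.eq_empty_or_nonempty {s : ℝ | 0 < s ∧
      H ≤ 2 * Real.sqrt (2 * s) * genInv α s + K * genInv α s ^ 2} with h0 | ⟨s', hs'⟩
    · rw [betaOf, h0, Real.sInf_empty]
      exact hs.le
    · refine (csInf_le hbdd hs').trans ?_
      by_contra! hlt
      have hempty : {r : ℝ | 0 ≤ r ∧ s' < α r} = ∅ := by
        refine Set.eq_empty_of_forall_notMem fun r hr => hne ⟨r, hr.1, hlt.trans hr.2⟩
      have h1 := hs'.2
      rw [genInv, hempty, Real.sInf_empty] at h1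
      simp only [mul_zero, ne_eq, OfNat.ofNat_ne_zero, not_false_eq_true, zero_pow,
        add_zero] at h1
      linarith

lemma betaOf_nonpos {α : ℝ → ℝ} {K H : ℝ} (hK : 0 ≤ K) (hH : H ≤ 0) : betaOf α K H ≤ 0 := by
  refine le_of_forall_pos_le_add fun s hs => ?_
  rw [zero_add]
  have := genInv_nonneg α s
  exact csInf_le ⟨0, fun _ hr => hr.1.le⟩ ⟨hs, hH.trans (by positivity)⟩

/-- Truncation of a bounded `C¹` function by smooth cutoffs. -/
lemma exists_hasCompactSupport_approx {E : Type*} [NormedAddCommGroup E] [InnerProductSpace ℝ E]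
    [FiniteDimensional ℝ E] [MeasurableSpace E] [BorelSpace E] {μ : Measure E} [IsFiniteMeasure μ]
    {P : E → ℝ} (hP : ContDiff ℝ 1 P) {B : ℝ} (hB : ∀ x, |P x| ≤ B)
    (hDP : Integrable (fun x => ‖fderiv ℝ P x‖ ^ 2) μ) :
    ∃ Q : ℕ → E → ℝ, (∀ k, ContDiff ℝ 1 (Q k)) ∧ (∀ k, HasCompactSupport (Q k)) ∧
      Filter.Tendsto (fun k => ∫ x, Real.exp (Q k x) ∂μ) Filter.atTop
        (nhds (∫ x, Real.exp (P x) ∂μ)) ∧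
      Filter.Tendsto (fun k => ∫ x, Q k x * Real.exp (Q k x) ∂μ) Filter.atTop
        (nhds (∫ x, P x * Real.exp (P x) ∂μ)) ∧
      Filter.Tendsto (fun k => ∫ x, ‖fderiv ℝ (Q k) x‖ ^ 2 * Real.exp (Q k x) ∂μ) Filter.atTop
        (nhds (∫ x, ‖fderiv ℝ P x‖ ^ 2 * Real.exp (P x) ∂μ)) := by
  let ψ : ContDiffBump (0 : E) := ⟨1, 2, one_pos, one_lt_two⟩
  have hB0 : 0 ≤ B := (abs_nonneg _).trans (hB 0)
  have hψ : ContDiff ℝ 1 ψ := ψ.contDiff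
  obtain ⟨L, hL⟩ := (ψ.hasCompactSupport.fderiv (𝕜 := ℝ)).exists_bound_of_continuous
    (hψ.continuous_fderiv one_ne_zero)
  have hL0 : 0 ≤ L := (norm_nonneg _).trans (hL 0)
  set c : ℕ → ℝ := fun k => 1 / ((k : ℝ) + 1) with hc
  have hc0 : ∀ k, 0 < c k := fun k => by positivity
  have hc1 : ∀ k, c k ≤ 1 := fun k => by
    rw [hc]
    exact div_le_one_of_le₀ (by linarith [k.cast_nonneg (α := ℝ)]) (by positivity)
  set χ : ℕ → E → ℝ := fun k x => ψ (c k • x) with hχ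
  have hχd : ∀ k, ContDiff ℝ 1 (χ k) := fun k => hψ.comp (contDiff_const_smul (c k))
  set Q : ℕ → E → ℝ := fun k x => χ k x * P x with hQdef
  have hQ : ∀ k, ContDiff ℝ 1 (Q k) := fun k => (hχd k).mul hP
  have hQc : ∀ k, Continuous (Q k) := fun k => (hQ k).continuous
  have hDQc : ∀ k, Continuous (fderiv ℝ (Q k)) := fun k => (hQ k).continuous_fderiv one_ne_zero
  have hχabs : ∀ k x, |χ k x| ≤ 1 := fun k x => by
    rw [abs_of_nonneg ψ.nonneg]
    exact ψ.le_one
  have hQabs : ∀ k x, |Q k x| ≤ B := fun k x => by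
    rw [hQdef, abs_mul]
    exact (mul_le_mul (hχabs k x) (hB x) (abs_nonneg _) zero_le_one).trans_eq (one_mul B)
  have hexp : ∀ k x, Real.exp (Q k x) ≤ Real.exp B := fun k x =>
    Real.exp_le_exp.mpr (le_of_abs_le (hQabs k x))
  have hDQ : ∀ k x, ‖fderiv ℝ (Q k) x‖ ≤ ‖fderiv ℝ P x‖ + B * L := by
    intro k x
    rw [hQdef, fderiv_fun_mul ((hχd k).differentiable one_ne_zero x)
      (hP.differentiable one_ne_zero x)]
    have h1 : ‖fderiv ℝ (χ k) x‖ ≤ L := by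
      rw [hχ]
      have := fderiv_comp_smul (𝕜 := ℝ) (f := ψ) (x := x) (c k)
      rw [this, norm_smul, Real.norm_of_nonneg (hc0 k).le]
      exact (mul_le_mul (hc1 k) (hL _) (norm_nonneg _) zero_le_one).trans_eq (one_mul L)
    refine (norm_add_le _ _).trans (add_le_add ?_ ?_)
    · rw [norm_smul, Real.norm_eq_abs]
      exact mul_le_of_le_one_left (norm_nonneg _) (hχabs k x)
    · rw [norm_smul, Real.norm_eq_abs]
      exact mul_le_mul (hB x) h1 (norm_nonneg _) hB0
  have hev : ∀ x, ∀ᶠ k in Filter.atTop, Q k x = P x ∧ fderiv ℝ (Q k) x = fderiv ℝ P x := by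
    intro x
    obtain ⟨N, hN⟩ := exists_nat_gt ‖x‖
    filter_upwards [Filter.eventually_ge_atTop N] with k hk
    have hk' : ‖x‖ < (k : ℝ) + 1 := by
      have : (N : ℝ) ≤ k := by exact_mod_cast hk
      linarith
    have hnear : Q k =ᶠ[nhds x] P := by
      filter_upwards [(isOpen_lt continuous_norm continuous_const).mem_nhds
        (show x ∈ {z : E | ‖z‖ < (k : ℝ) + 1} from hk')] with z hz
      have h1 : ψ (c k • z) = 1 := by
        apply ψ.one_of_mem_closedBall
        rw [mem_closedBall_zero_iff, norm_smul, Real.norm_of_nonneg (hc0 k).le, hc]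
        change 1 / ((k : ℝ) + 1) * ‖z‖ ≤ 1
        rw [one_div_mul_eq_div]
        exact div_le_one_of_le₀ (le_of_lt hz) (by positivity)
      simp only [hQdef, hχ, h1, one_mul]
    exact ⟨hnear.eq_of_nhds, hnear.fderiv_eq⟩
  refine ⟨Q, hQ, fun k => ?_, ?_, ?_, ?_⟩
  · exact (ψ.hasCompactSupport.comp_smul (hc0 k).ne').mul_right
  · refine tendsto_integral_of_dominated_convergence (fun _ => Real.exp B)
      (fun k => Continuous.aestronglyMeasurable (by fun_prop)) (integrable_const _)
      (fun k => Filter.Eventually.of_forall fun x => ?_)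
      (Filter.Eventually.of_forall fun x => tendsto_const_nhds.congr' ?_)
    · rw [Real.norm_eq_abs, Real.abs_exp]
      exact hexp k x
    · filter_upwards [hev x] with k hk
      rw [hk.1]
  · refine tendsto_integral_of_dominated_convergence (fun _ => B * Real.exp B)
      (fun k => Continuous.aestronglyMeasurable (by fun_prop)) (integrable_const _)
      (fun k => Filter.Eventually.of_forall fun x => ?_)
      (Filter.Eventually.of_forall fun x => tendsto_const_nhds.congr' ?_)
    · rw [Real.norm_eq_abs, abs_mul, Real.abs_exp]
      exact mul_le_mul (hQabs k x) (hexp k x) (Real.exp_pos _).le hB0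
    · filter_upwards [hev x] with k hk
      rw [hk.1]
  · refine tendsto_integral_of_dominated_convergence
      (fun x => (2 * ‖fderiv ℝ P x‖ ^ 2 + 2 * (B * L) ^ 2) * Real.exp B)
      (fun k => Continuous.aestronglyMeasurable (by fun_prop))
      (((hDP.const_mul 2).add (integrable_const _)).mul_const _)
      (fun k => Filter.Eventually.of_forall fun x => ?_)
      (Filter.Eventually.of_forall fun x => tendsto_const_nhds.congr' ?_)
    · rw [Real.norm_of_nonneg (by positivity)]
      refine mul_le_mul ?_ (hexp k x) (Real.exp_pos _).le (by positivity)
      have h1 := pow_le_pow_left₀ (norm_nonneg _) (hDQ k x) 2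
      have h2 := sq_nonneg (‖fderiv ℝ P x‖ - B * L)
      linarith
    · filter_upwards [hev x] with k hk
      rw [hk.1, hk.2]

lemma entropy_le_of_fisher_lt {n : ℕ} {U : EuclideanSpace ℝ (Fin n) → ℝ}
    (hU : Continuous U) {μ : Measure (EuclideanSpace ℝ (Fin n))} [IsProbabilityMeasure μ]
    (hμ : μ = volume.withDensity fun x => ENNReal.ofReal (Real.exp (-U x))) {K : ℝ} (hK : 0 ≤ K)
    (hconv : ∀ x y (s t : ℝ), 0 < s → 0 < t → s + t = 1 →
      U (s • x + t • y) ≤ s * U x + t * U y + K * s * t / 2 * ‖x - y‖ ^ 2)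
    {α : ℝ → ℝ} (hα : ∀ ν : Measure (EuclideanSpace ℝ (Fin n)), IsProbabilityMeasure ν →
      ∀ r : ℝ, 0 ≤ r → ENNReal.ofReal r ≤ wassersteinDist 2 ν μ →
        ENNReal.ofReal (α r) ≤ fisherInfo ν μ)
    {s : ℝ} (hs : 0 < s) (hne : {r : ℝ | 0 ≤ r ∧ s < α r}.Nonempty)
    {Q : EuclideanSpace ℝ (Fin n) → ℝ} (hQ : ContDiff ℝ 1 Q) (hQc : HasCompactSupport Q)
    (hI : ∫ x, ‖fderiv ℝ Q x‖ ^ 2 * Real.exp (Q x) ∂μ < 4 * s * ∫ x, Real.exp (Q x) ∂μ) :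
    (∫ x, Q x * Real.exp (Q x) ∂μ) -
        (∫ x, Real.exp (Q x) ∂μ) * Real.log (∫ x, Real.exp (Q x) ∂μ) ≤
      (∫ x, Real.exp (Q x) ∂μ) *
        (2 * Real.sqrt (2 * s) * genInv α s + K * genInv α s ^ 2) := by
  have hQcont := hQ.continuous
  have hDQ : Continuous (fderiv ℝ Q) := hQ.continuous_fderiv one_ne_zero
  obtain ⟨B, hB⟩ := hQc.exists_bound_of_continuous hQcont
  obtain ⟨L, hL⟩ := (hQc.fderiv (𝕜 := ℝ)).exists_bound_of_continuous hDQ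
  have hexp : ∀ x, |Real.exp (Q x)| ≤ Real.exp B := fun x => by
    rw [Real.abs_exp]
    exact Real.exp_le_exp.mpr (le_of_abs_le (hB x))
  have iexp : Integrable (fun x => Real.exp (Q x)) μ :=
    (integrable_const (Real.exp B)).mono' (Continuous.aestronglyMeasurable (by fun_prop))
      (Filter.Eventually.of_forall hexp)
  have iD : Integrable (fun x => ‖fderiv ℝ Q x‖ ^ 2 * Real.exp (Q x)) μ := by
    refine (integrable_const (L ^ 2 * Real.exp B)).mono'
      (Continuous.aestronglyMeasurable (by fun_prop)) (Filter.Eventually.of_forall fun x => ?_)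
    rw [norm_mul, norm_pow, norm_norm]
    exact mul_le_mul (pow_le_pow_left₀ (norm_nonneg _) (hL x) 2) (hexp x) (abs_nonneg _)
      (by positivity)
  set m := ∫ x, Real.exp (Q x) ∂μ with hm
  set I := ∫ x, ‖fderiv ℝ Q x‖ ^ 2 * Real.exp (Q x) ∂μ with hIdef
  set S := (∫ x, Q x * Real.exp (Q x) ∂μ) - m * Real.log m with hS
  have hmpos : 0 < m := integral_exp_pos iexp
  set ν := μ.withDensity fun x => ENNReal.ofReal (Real.exp (Q x) / m) with hν
  have hνprob : IsProbabilityMeasure ν := ⟨by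
    rw [hν, withDensity_apply _ MeasurableSet.univ, Measure.restrict_univ,
      ← ofReal_integral_eq_lintegral_ofReal (iexp.div_const m)
        (Filter.Eventually.of_forall fun x => by positivity), integral_div, ← hm,
      div_self hmpos.ne', ENNReal.ofReal_one]⟩
  have hfisher : fisherInfo ν μ < ENNReal.ofReal s := by
    refine (fisherInfo_exp_le (hQ.differentiable one_ne_zero) hmpos iD).trans_lt ?_
    rw [ENNReal.ofReal_lt_ofReal_iff hs, one_div_mul_eq_div, div_lt_iff₀ (by positivity)]
    linarith
  have hW := wassersteinDist_le_genInv (hα ν hνprob) hs hne hfisher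
  set a := genInv α s with ha_def
  have ha : 0 ≤ a := genInv_nonneg α s
  have key : ∀ κ, K < κ → S ≤ m * (κ / 2 * a ^ 2) + 1 / (2 * (κ - K)) * (4 * s * m) := by
    intro κ hκ
    have hκ0 : 0 < κ := hK.trans_lt hκ
    refine le_of_forall_pos_le_add fun ε hε => ?_
    obtain ⟨π, hπ, hint, hcost⟩ := exists_coupling_of_wassersteinDist_two_le ha hW
      (δ := 2 * ε / (m * κ)) (by positivity)
    have h1 := entropy_le_transport_add_fisher hU hμ hconv hQ hQc hπ.1 hπ.2 hint hκ0 hκ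
    have h2 : m * (κ / 2 * ∫ q, ‖q.1 - q.2‖ ^ 2 ∂π) ≤ m * (κ / 2 * a ^ 2) + ε := by
      have h3 : m * (κ / 2 * ∫ q, ‖q.1 - q.2‖ ^ 2 ∂π) ≤
          m * (κ / 2 * (a ^ 2 + 2 * ε / (m * κ))) := by gcongr
      refine h3.trans_eq ?_
      field_simp
    have h4 : 1 / (2 * (κ - K)) * I ≤ 1 / (2 * (κ - K)) * (4 * s * m) :=
      mul_le_mul_of_nonneg_left hI.le (one_div_nonneg.mpr (by linarith))
    linarith
  rcases ha.eq_or_lt with ha0 | hapos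
  · rw [← ha0]
    refine le_of_forall_pos_le_add fun ε hε => ?_
    have h1 := key (K + 2 * s * m / ε) (lt_add_of_pos_right K (by positivity))
    rw [← ha0, add_sub_cancel_left] at h1
    have h2 : 1 / (2 * (2 * s * m / ε)) * (4 * s * m) = ε := by
      field_simp
      norm_num
    rw [h2] at h1
    linarith
  · have hr : 0 < Real.sqrt s := Real.sqrt_pos.mpr hs
    have hss : Real.sqrt s * Real.sqrt s = s := Real.mul_self_sqrt hs.le
    have h1 := key (K + 2 * Real.sqrt s / a) (lt_add_of_pos_right K (by positivity))
    rw [add_sub_cancel_left] at h1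
    have h2 : m * ((K + 2 * Real.sqrt s / a) / 2 * a ^ 2) +
        1 / (2 * (2 * Real.sqrt s / a)) * (4 * s * m) =
        m * (2 * Real.sqrt s * a + K * a ^ 2 / 2) := by
      have h3 : 1 / (2 * (2 * Real.sqrt s / a)) * (4 * s * m) = m * (Real.sqrt s * a) := by
        nth_rewrite 2 [← hss]
        field_simp
        norm_num
      rw [h3]
      field_simp
      ring
    rw [h2] at h1
    refine h1.trans (mul_le_mul_of_nonneg_left ?_ hmpos.le)
    have h4 : Real.sqrt s ≤ Real.sqrt (2 * s) := Real.sqrt_le_sqrt (by linarith)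
    have h5 : 0 ≤ K * a ^ 2 := by positivity
    have h6 : 2 * Real.sqrt s * a ≤ 2 * Real.sqrt (2 * s) * a := by gcongr
    linarith

/-- The conclusion of `entropy_le_of_fisher_lt` for bounded functions of finite energy. -/
lemma entropy_le_of_fisher_lt_of_bounded {n : ℕ} {μ : Measure (EuclideanSpace ℝ (Fin n))}
    [IsFiniteMeasure μ] {s T : ℝ}
    (h : ∀ Q : EuclideanSpace ℝ (Fin n) → ℝ, ContDiff ℝ 1 Q → HasCompactSupport Q →
      ∫ x, ‖fderiv ℝ Q x‖ ^ 2 * Real.exp (Q x) ∂μ < 4 * s * ∫ x, Real.exp (Q x) ∂μ →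
      (∫ x, Q x * Real.exp (Q x) ∂μ) -
        (∫ x, Real.exp (Q x) ∂μ) * Real.log (∫ x, Real.exp (Q x) ∂μ) ≤
      (∫ x, Real.exp (Q x) ∂μ) * T)
    {P : EuclideanSpace ℝ (Fin n) → ℝ} (hP : ContDiff ℝ 1 P) {B : ℝ} (hB : ∀ x, |P x| ≤ B)
    (hDP : Integrable (fun x => ‖fderiv ℝ P x‖ ^ 2) μ)
    (hI : ∫ x, ‖fderiv ℝ P x‖ ^ 2 * Real.exp (P x) ∂μ < 4 * s * ∫ x, Real.exp (P x) ∂μ) :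
    (∫ x, P x * Real.exp (P x) ∂μ) -
        (∫ x, Real.exp (P x) ∂μ) * Real.log (∫ x, Real.exp (P x) ∂μ) ≤
      (∫ x, Real.exp (P x) ∂μ) * T := by
  obtain ⟨Q, hQ, hQc, h1, h2, h3⟩ := exists_hasCompactSupport_approx hP hB hDP
  refine le_of_tendsto_of_tendsto
    (h2.sub ((Real.continuous_mul_log.tendsto _).comp h1)) (h1.mul_const T) ?_
  filter_upwards [h3.eventually_lt (h1.const_mul (4 * s)) hI] with k hk
  exact h (Q k) (hQ k) (hQc k) hk

lemma fderiv_log_sq_add {E : Type*} [NormedAddCommGroup E] [NormedSpace ℝ E] {g : E → ℝ}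
    (hg : Differentiable ℝ g) {ε : ℝ} (hε : 0 < ε) (x : E) :
    ‖fderiv ℝ (fun x => Real.log (g x ^ 2 + ε)) x‖ ^ 2 * (g x ^ 2 + ε) ≤
      4 * ‖fderiv ℝ g x‖ ^ 2 := by
  have hF : 0 < g x ^ 2 + ε := by positivity
  have hd : HasFDerivAt (fun x => Real.log (g x ^ 2 + ε))
      ((g x ^ 2 + ε)⁻¹ • ((2 * g x) • fderiv ℝ g x)) x := by
    refine HasFDerivAt.log ?_ hF.ne'
    refine (((hg x).hasFDerivAt.pow 2).add_const ε).congr_fderiv ?_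
    simp
  rw [hd.fderiv, norm_smul, norm_smul, mul_pow, mul_pow, Real.norm_eq_abs, Real.norm_eq_abs,
    sq_abs, sq_abs]
  have h1 : ((g x ^ 2 + ε)⁻¹) ^ 2 * ((2 * g x) ^ 2 * ‖fderiv ℝ g x‖ ^ 2) * (g x ^ 2 + ε) =
      4 * ‖fderiv ℝ g x‖ ^ 2 * (g x ^ 2 / (g x ^ 2 + ε)) := by
    field_simp
    ring
  rw [h1]
  exact mul_le_of_le_one_right (by positivity) ((div_le_one hF).mpr (by linarith))

lemma integral_sq_mul_log_sq_le {n : ℕ} {μ : Measure (EuclideanSpace ℝ (Fin n))}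
    [IsProbabilityMeasure μ] {s T : ℝ} (hs : 0 < s)
    (h : ∀ Q : EuclideanSpace ℝ (Fin n) → ℝ, ContDiff ℝ 1 Q → HasCompactSupport Q →
      ∫ x, ‖fderiv ℝ Q x‖ ^ 2 * Real.exp (Q x) ∂μ < 4 * s * ∫ x, Real.exp (Q x) ∂μ →
      (∫ x, Q x * Real.exp (Q x) ∂μ) -
        (∫ x, Real.exp (Q x) ∂μ) * Real.log (∫ x, Real.exp (Q x) ∂μ) ≤
      (∫ x, Real.exp (Q x) ∂μ) * T)
    {g : EuclideanSpace ℝ (Fin n) → ℝ} (hg : ContDiff ℝ 1 g) {M : ℝ} (hM : ∀ x, |g x| ≤ M)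
    (hg1 : ∫ x, g x ^ 2 ∂μ = 1) (hDg : Integrable (fun x => ‖fderiv ℝ g x‖ ^ 2) μ)
    (hI : ∫ x, ‖fderiv ℝ g x‖ ^ 2 ∂μ < s) :
    ∫ x, g x ^ 2 * Real.log (g x ^ 2) ∂μ ≤ T := by
  have hgc := hg.continuous
  have hgM : ∀ x, g x ^ 2 ≤ M ^ 2 := fun x => sq_le_sq' (neg_le_of_abs_le (hM x))
    (le_of_abs_le (hM x))
  have ig : Integrable (fun x => g x ^ 2) μ :=
    (integrable_const (M ^ 2)).mono' (Continuous.aestronglyMeasurable (by fun_prop))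
      (Filter.Eventually.of_forall fun x => by
        rw [Real.norm_of_nonneg (sq_nonneg _)]
        exact hgM x)
  have hbound : ∀ ε : ℝ, 0 < ε →
      (∫ x, (g x ^ 2 + ε) * Real.log (g x ^ 2 + ε) ∂μ) - (1 + ε) * Real.log (1 + ε) ≤
        (1 + ε) * T := by
    intro ε hε
    have hF : ∀ x, 0 < g x ^ 2 + ε := fun x => by positivity
    have hP : ContDiff ℝ 1 fun x => Real.log (g x ^ 2 + ε) :=
      ((hg.pow 2).add contDiff_const).log fun x => (hF x).ne'
    have hDPc := hP.continuous_fderiv one_ne_zero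
    have hDP := fderiv_log_sq_add (hg.differentiable one_ne_zero) hε
    have iDP : Integrable (fun x => ‖fderiv ℝ (fun x => Real.log (g x ^ 2 + ε)) x‖ ^ 2) μ := by
      refine (hDg.const_mul (4 / ε)).mono' (Continuous.aestronglyMeasurable (by fun_prop))
        (Filter.Eventually.of_forall fun x => ?_)
      rw [Real.norm_of_nonneg (by positivity), div_mul_eq_mul_div, le_div_iff₀ hε]
      refine le_trans (mul_le_mul_of_nonneg_left ?_ (by positivity)) (hDP x)
      exact le_add_of_nonneg_left (sq_nonneg _)
    have hmass : ∫ x, (g x ^ 2 + ε) ∂μ = 1 + ε := by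
      rw [integral_add ig (integrable_const ε), hg1]
      simp
    have h1 := entropy_le_of_fisher_lt_of_bounded h hP
      (B := max |Real.log ε| |Real.log (M ^ 2 + ε)|) (fun x => abs_le_max_abs_abs
        (Real.log_le_log hε (le_add_of_nonneg_left (sq_nonneg _)))
        (Real.log_le_log (hF x) (by linarith [hgM x]))) iDP
    simp only [Real.exp_log (hF _), hmass] at h1
    have h2 : ∫ x, ‖fderiv ℝ (fun x => Real.log (g x ^ 2 + ε)) x‖ ^ 2 * (g x ^ 2 + ε) ∂μ <
        4 * s * (1 + ε) := by
      have h3 := integral_mono_of_nonneg (μ := μ)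
        (Filter.Eventually.of_forall fun x => mul_nonneg (sq_nonneg _) (hF x).le)
        (hDg.const_mul 4) (Filter.Eventually.of_forall hDP)
      rw [integral_const_mul] at h3
      have : 0 < s * ε := by positivity
      linarith
    simpa only [mul_comm] using h1 h2
  set ε : ℕ → ℝ := fun k => 1 / ((k : ℝ) + 1) with hεdef
  have hε0 : ∀ k, 0 < ε k := fun k => by positivity
  have hε1 : ∀ k, ε k ≤ 1 := fun k =>
    div_le_one_of_le₀ (by linarith [k.cast_nonneg (α := ℝ)]) (by positivity)
  have hεlim : Filter.Tendsto ε Filter.atTop (nhds 0) := tendsto_one_div_add_atTop_nhds_zero_nat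
  obtain ⟨C, hC⟩ := (isCompact_Icc (a := (0 : ℝ)) (b := M ^ 2 + 1)).exists_bound_of_continuousOn
    Real.continuous_mul_log.continuousOn
  have hlim : Filter.Tendsto (fun k => ∫ x, (g x ^ 2 + ε k) * Real.log (g x ^ 2 + ε k) ∂μ)
      Filter.atTop (nhds (∫ x, g x ^ 2 * Real.log (g x ^ 2) ∂μ)) := by
    refine tendsto_integral_of_dominated_convergence (fun _ => C)
      (fun k => (Real.continuous_mul_log.comp
        ((hgc.pow 2).add continuous_const)).aestronglyMeasurable) (integrable_const _)
      (fun k => Filter.Eventually.of_forall fun x => ?_)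
      (Filter.Eventually.of_forall fun x => ?_)
    · exact hC _ ⟨by have := hε0 k; positivity, add_le_add (hgM x) (hε1 k)⟩
    · have h1 : Filter.Tendsto (fun k => g x ^ 2 + ε k) Filter.atTop (nhds (g x ^ 2)) := by
        simpa using hεlim.const_add (g x ^ 2)
      exact (Real.continuous_mul_log.tendsto _).comp h1
  have hone : Filter.Tendsto (fun k => 1 + ε k) Filter.atTop (nhds 1) := by
    simpa using hεlim.const_add 1
  have hfin := le_of_tendsto_of_tendsto'
    (hlim.sub ((Real.continuous_mul_log.tendsto _).comp hone)) (hone.mul_const T)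
    fun k => hbound (ε k) (hε0 k)
  simpa using hfin

/-- **Theorem 4.1 (2)**: if `Hess V ≥ −K` and `μ` satisfies `α(W₂(ν,μ)) ≤ I(ν|μ)`
(encoded as `α(r) ≤ I(ν|μ)` whenever `r ≤ W₂(ν,μ)`), then the `β`-log-Sobolev
inequality `β(μ(g² log g²)) ≤ μ(|∇g|²)` holds with
`β(r) = inf{ s > 0 : 2√(2s) α^{−1}(s) + K (α^{−1}(s))² ≥ r }`. -/
theorem alphaW2I_implies_beta_logSobolev {n : ℕ}
    (V : EuclideanSpace ℝ (Fin n) → ℝ) (hV : ContDiff ℝ 2 V) (Z : ℝ) (hZ : 0 < Z)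
    (μ : Measure (EuclideanSpace ℝ (Fin n)))
    (hμ : μ = volume.withDensity fun x => ENNReal.ofReal (Real.exp (-V x) / Z))
    (hμprob : IsProbabilityMeasure μ)
    (K : ℝ) (hK : 0 ≤ K)
    (hHess : ∀ x v : EuclideanSpace ℝ (Fin n),
      -(K * ‖v‖ ^ 2) ≤ iteratedFDeriv ℝ 2 V x ![v, v])
    (α : ℝ → ℝ) (hαnonneg : ∀ r, 0 ≤ r → 0 ≤ α r)
    (hαmono : MonotoneOn α (Set.Ici 0))
    (hαWI : ∀ ν : Measure (EuclideanSpace ℝ (Fin n)), IsProbabilityMeasure ν →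
      ∀ r : ℝ, 0 ≤ r → ENNReal.ofReal r ≤ wassersteinDist 2 ν μ →
        ENNReal.ofReal (α r) ≤ fisherInfo ν μ) :
    ∀ g : EuclideanSpace ℝ (Fin n) → ℝ, ContDiff ℝ 1 g →
      (∃ M, ∀ x, |g x| ≤ M) → (∫ x, g x ^ 2 ∂μ) = 1 →
      ENNReal.ofReal (betaOf α K (∫ x, g x ^ 2 * Real.log (g x ^ 2) ∂μ)) ≤
        ∫⁻ x, (‖gradient g x‖₊ : ℝ≥0∞) ^ 2 ∂μ := by
  rintro g hg ⟨M, hM⟩ hg1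
  have hVc := hV.continuous
  set U : EuclideanSpace ℝ (Fin n) → ℝ := fun x => V x + Real.log Z with hUdef
  have hU : Continuous U := by fun_prop
  have hμU : μ = volume.withDensity fun x => ENNReal.ofReal (Real.exp (-U x)) := by
    simp only [hUdef, neg_add, Real.exp_add, Real.exp_neg (Real.log Z), Real.exp_log hZ,
      ← div_eq_mul_inv]
    exact hμ
  have hconv : ∀ x y (s t : ℝ), 0 < s → 0 < t → s + t = 1 →
      U (s • x + t • y) ≤ s * U x + t * U y + K * s * t / 2 * ‖x - y‖ ^ 2 := by
    intro x y s t hs ht hst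
    have h1 := le_add_sq_of_neg_le_iteratedFDeriv hV hHess x y hs ht hst
    have h2 : s * Real.log Z + t * Real.log Z = Real.log Z := by rw [← add_mul, hst, one_mul]
    simp only [hUdef]
    linarith
  rw [lintegral_nnnorm_gradient_sq]
  by_cases hfin : ∫⁻ x, ENNReal.ofReal (‖fderiv ℝ g x‖ ^ 2) ∂μ = ⊤
  · rw [hfin]
    exact le_top
  have hDgc := hg.continuous_fderiv one_ne_zero
  have hDg : Integrable (fun x => ‖fderiv ℝ g x‖ ^ 2) μ := by
    refine ⟨Continuous.aestronglyMeasurable (by fun_prop), ?_⟩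
    rw [hasFiniteIntegral_iff_ofReal (Filter.Eventually.of_forall fun x => by positivity)]
    exact lt_top_iff_ne_top.mpr hfin
  rw [← ofReal_integral_eq_lintegral_ofReal hDg
    (Filter.Eventually.of_forall fun x => by positivity)]
  have hI0 : 0 ≤ ∫ x, ‖fderiv ℝ g x‖ ^ 2 ∂μ := integral_nonneg fun x => by positivity
  refine ENNReal.ofReal_le_ofReal ?_
  rcases le_or_gt (∫ x, g x ^ 2 * Real.log (g x ^ 2) ∂μ) 0 with hH | hH
  · exact (betaOf_nonpos hK hH).trans hI0
  refine le_of_forall_gt_imp_ge_of_dense fun s hs => ?_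
  have hs0 : 0 < s := hI0.trans_lt hs
  refine betaOf_le hs0 (fun hne => ?_) hH
  exact integral_sq_mul_log_sq_le hs0
    (fun Q hQ hQc hI => entropy_le_of_fisher_lt hU hμU hK hconv hαWI hs0 hne hQ hQc hI)
    hg hM hg1 hDg hs
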